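/- arXiv:2011.04327 — 6 statements merged into one kernel-verified Lean document; each statement's English description precedes it below -/
import Mathlib

section
/- For every integer n ≥ 3, the antiprism graph A_n = A[n,1] has the PMH-property: every perfect matching M of A[n,1] can be extended to a Hamiltonian cycle of A[n,1], i.e., there exists a perfect matching N of A[n,1] such that M ∪ N is the edge set of a Hamiltonian cycle of A[n,1]. -/
open SimpleGraph

/-- The accordion graph `A[n,k]`: vertices `u_i = (false, i)` and `v_i = (true, i)`
for `i : ZMod n`, with edges `u_i u_{i+1}`, `v_i v_{i+1}`, `u_i v_i`, `u_i v_{i+k}`. -/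
def accordion (n k : ℕ) : SimpleGraph (Bool × ZMod n) :=
  SimpleGraph.fromRel (fun x y =>
    (x.1 = y.1 ∧ y.2 = x.2 + 1) ∨
    (x.1 = false ∧ y.1 = true ∧ (y.2 = x.2 ∨ y.2 = x.2 + (k : ZMod n))))

/-- A graph `G` has the PMH-property if every perfect matching `M` of `G` extends to a
Hamiltonian cycle of `G`, i.e. there is a perfect matching `N` of `G` such that `M ∪ N`
is the edge set of a Hamiltonian cycle of `G`. -/
def IsPMH {V : Type} [DecidableEq V] (G : SimpleGraph V) : Prop :=
  ∀ M : G.Subgraph, M.IsPerfectMatching →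
    ∃ N : G.Subgraph, N.IsPerfectMatching ∧
      ∃ (v : V) (c : G.Walk v v), c.IsHamiltonianCycle ∧
        {e | e ∈ c.edges} = M.edgeSet ∪ N.edgeSet

/-- An alternating sequence `L 0, R 0, L 1, R 1, …` of adjacent vertices traces a walk. -/
theorem SimpleGraph.exists_walk_of_alternating {V : Type} {G : SimpleGraph V} {L R : ℕ → V}
    (hLR : ∀ j, G.Adj (L j) (R j)) (hRL : ∀ j, G.Adj (R j) (L (j + 1))) (m : ℕ) :
    ∃ p : G.Walk (L 0) (L m), p.length = 2 * m ∧
      (∀ e, e ∈ p.edges ↔ ∃ j < m, e = s(L j, R j) ∨ e = s(R j, L (j + 1))) ∧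
      (∀ j < m, R j ∈ p.support.tail ∧ L (j + 1) ∈ p.support.tail) := by
  induction m with
  | zero => exact ⟨Walk.nil, by simp⟩
  | succ m ih =>
    obtain ⟨p, hlen, hedge, hsupp⟩ := ih
    refine ⟨p.append (Walk.cons (hLR m) (Walk.cons (hRL m) Walk.nil)), ?_, ?_, ?_⟩
    · simp [hlen]; ring
    · intro e
      simp only [Walk.edges_append, List.mem_append, hedge, Walk.edges_cons, Walk.edges_nil,
        List.mem_cons, List.not_mem_nil, or_false]
      grind
    · intro j hj
      simp only [Walk.tail_support_append, Walk.support_cons, Walk.support_nil, List.tail_cons,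
        List.mem_append, List.mem_cons, List.not_mem_nil, or_false]
      grind

/-- A closed walk of length at least three with as many steps as there are vertices, visiting
every vertex after its start, is a Hamiltonian cycle. -/
theorem SimpleGraph.Walk.isHamiltonianCycle_of_length_eq_card {V : Type} [DecidableEq V]
    [Fintype V] {G : SimpleGraph V} {v : V} (c : G.Walk v v) (hlen : c.length = Fintype.card V)
    (h3 : 3 ≤ c.length) (hsupp : ∀ x, x ∈ c.support.tail) : c.IsHamiltonianCycle := by
  have hnil : ¬ c.Nil := by
    intro h
    rw [← Walk.length_eq_zero_iff] at h
    omega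
  rw [Walk.isHamiltonianCycle_iff_isCycle_and_length_eq]
  refine ⟨Walk.isCycle_iff_isPath_tail_and_le_length.mpr ⟨?_, h3⟩, hlen⟩
  rw [Walk.isPath_def, Walk.support_tail_of_not_nil c hnil]
  rw [← Multiset.coe_nodup, ← Multiset.toFinset_card_eq_card_iff_nodup]
  have huniv : (c.support.tail : Multiset V).toFinset = Finset.univ := by
    ext x
    simpa using hsupp x
  rw [huniv, Finset.card_univ, ← hlen]
  simp

/-- Two perfect matchings, given by involutions `f` and `τ`, whose edges alternate along a
closed sequence through all the vertices form a Hamiltonian cycle. -/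
theorem SimpleGraph.exists_isHamiltonianCycle_of_alternating {V : Type} [DecidableEq V]
    [Fintype V] {G : SimpleGraph V} (M : G.Subgraph) {f τ : V → V} {L R : ℕ → V} {n : ℕ}
    (hn : 3 ≤ n) (hcard : Fintype.card V = 2 * n) (hM : ∀ a b, M.Adj a b ↔ b = f a)
    (hτ : ∀ a, τ (τ a) = a) (hτG : ∀ a, G.Adj a (τ a))
    (hLR : ∀ j, τ (L j) = R j) (hRL : ∀ j, f (R j) = L (j + 1)) (hL : L n = L 0)
    (hsurj : ∀ v, ∃ j < n, v = L j ∨ v = R j) :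
    ∃ N : G.Subgraph, N.IsPerfectMatching ∧
      ∃ (v : V) (c : G.Walk v v), c.IsHamiltonianCycle ∧
        {e | e ∈ c.edges} = M.edgeSet ∪ N.edgeSet := by
  have hfM : ∀ a, M.Adj a (f a) := fun a => (hM a _).mpr rfl
  have hff : ∀ a, f (f a) = a := fun a => ((hM _ _).mp (hfM a).symm).symm
  let N : G.Subgraph :=
    { verts := Set.univ
      Adj := fun a b => b = τ a
      adj_sub := by rintro a b rfl; exact hτG a
      edge_vert := fun _ => Set.mem_univ _
      symm := ⟨by rintro a b rfl; exact (hτ a).symm⟩ }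
  have hN : ∀ a b, N.Adj a b ↔ b = τ a := fun _ _ => Iff.rfl
  refine ⟨N, Subgraph.isPerfectMatching_iff.mpr fun v => ⟨τ v, rfl, fun _ h => h⟩, L 0, ?_⟩
  obtain ⟨p, hlen, hedge, hsupp⟩ := exists_walk_of_alternating (G := G) (L := L) (R := R)
    (fun j => hLR j ▸ hτG _) (fun j => hRL j ▸ (hfM _).adj_sub) n
  have hprev : ∀ j < n, ∃ i < n, L (i + 1) = L j := by
    intro j hj
    rcases j with _ | j
    · exact ⟨n - 1, by omega, by rw [Nat.sub_add_cancel (by omega), hL]⟩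
    · exact ⟨j, by omega, rfl⟩
  refine ⟨p.copy rfl hL, Walk.isHamiltonianCycle_of_length_eq_card _ ?_ ?_ ?_, ?_⟩
  · simp [hlen, hcard]
  · simp only [Walk.length_copy, hlen]; omega
  · intro x
    simp only [Walk.support_copy]
    obtain ⟨j, hj, rfl | rfl⟩ := hsurj x
    · obtain ⟨i, hi, hij⟩ := hprev j hj
      exact hij ▸ (hsupp i hi).2
    · exact (hsupp j hj).1
  · ext e
    induction e with | _ a b
    simp only [Walk.edges_copy, Set.mem_ofPred_eq, hedge, Set.mem_union, Subgraph.mem_edgeSet,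
      hM, hN, Sym2.eq_iff]
    constructor
    · rintro ⟨j, -, (⟨rfl, rfl⟩ | ⟨rfl, rfl⟩) | (⟨rfl, rfl⟩ | ⟨rfl, rfl⟩)⟩ <;> grind
    · rintro (rfl | rfl) <;> obtain ⟨j, hj, rfl | rfl⟩ := hsurj a
      · obtain ⟨i, hi, hij⟩ := hprev j hj
        exact ⟨i, hi, by grind⟩
      all_goals exact ⟨j, hj, by grind⟩

/-- The matching `f` crosses the block `{x, σ x}` exactly once to the right: it does not match
`x` with `σ x`, and exactly one of the two is matched to a `σ`-later vertex. -/
def IsTransverse {V : Type} (σ f : V → V) (x : V) : Prop :=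
  f x ≠ σ x ∧
    ((f x = σ (σ x) ∧ ¬ (f (σ x) = σ (σ x) ∨ f (σ x) = σ (σ (σ x)))) ∨
     (f x ≠ σ (σ x) ∧ (f (σ x) = σ (σ x) ∨ f (σ x) = σ (σ (σ x)))))

section Transverse

variable {V : Type} {σ f : V → V}

theorem IsTransverse.next (hσ : Function.Injective σ) (hf : ∀ x, f (f x) = x)
    (hadj : ∀ x, f x = σ x ∨ f x = σ (σ x) ∨ σ (f x) = x ∨ σ (σ (f x)) = x)
    (h1 : ∀ x, σ x ≠ x) (h2 : ∀ x, σ (σ x) ≠ x) (h3 : ∀ x, σ (σ (σ x)) ≠ x)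
    (h4 : ∀ x, σ (σ (σ (σ x))) ≠ x)
    {x : V} (h : IsTransverse σ f x) : IsTransverse σ f (σ (σ x)) := by
  unfold IsTransverse at *
  have := hadj x
  have := hadj (σ x)
  have := hadj (σ (σ x))
  have := hadj (σ (σ (σ x)))
  grind [Function.Injective]

theorem isTransverse_or (hσ : Function.Injective σ) (hf : ∀ x, f (f x) = x)
    (hadj : ∀ x, f x = σ x ∨ f x = σ (σ x) ∨ σ (f x) = x ∨ σ (σ (f x)) = x)
    (h1 : ∀ x, σ x ≠ x) (h2 : ∀ x, σ (σ x) ≠ x) (h3 : ∀ x, σ (σ (σ x)) ≠ x)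
    (h4 : ∀ x, σ (σ (σ (σ x))) ≠ x)
    (x : V) : IsTransverse σ f x ∨ IsTransverse σ f (σ x) := by
  unfold IsTransverse
  have := hadj x
  have := hadj (σ x)
  have := hadj (σ (σ x))
  grind [Function.Injective]

theorem IsTransverse.apply_right_eq_left [DecidableEq V]
    (hf : ∀ x, f (f x) = x) (h3 : ∀ x, σ (σ (σ x)) ≠ x) (h4 : ∀ x, σ (σ (σ (σ x))) ≠ x)
    {x : V} (h : IsTransverse σ f x) (h' : IsTransverse σ f (σ (σ x))) :
    f (if f x = σ (σ x) then x else σ x) =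
      if f (σ (σ x)) = σ (σ (σ (σ x))) then σ (σ (σ x)) else σ (σ x) := by
  unfold IsTransverse at *
  grind

end Transverse

namespace Antiprism

variable {n : ℕ}

/-- The successor in the cyclic order `v_0, u_0, v_1, u_1, …` of the vertices of the antiprism. -/
def succ (x : Bool × ZMod n) : Bool × ZMod n := (!x.1, if x.1 then x.2 else x.2 + 1)

/-- The predecessor in the cyclic order `v_0, u_0, v_1, u_1, …`. -/
def pred (x : Bool × ZMod n) : Bool × ZMod n := (!x.1, if x.1 then x.2 - 1 else x.2)

@[simp] theorem pred_succ (x : Bool × ZMod n) : pred (succ x) = x := by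
  obtain ⟨_ | _, i⟩ := x <;> simp [succ, pred]

@[simp] theorem succ_pred (x : Bool × ZMod n) : succ (pred x) = x := by
  obtain ⟨_ | _, i⟩ := x <;> simp [succ, pred]

theorem succ_injective : Function.Injective (succ (n := n)) :=
  Function.LeftInverse.injective pred_succ

@[simp] theorem fst_succ (x : Bool × ZMod n) : (succ x).1 = !x.1 := rfl

@[simp] theorem fst_pred (x : Bool × ZMod n) : (pred x).1 = !x.1 := rfl

@[simp] theorem succ_succ (x : Bool × ZMod n) : succ (succ x) = (x.1, x.2 + 1) := by
  obtain ⟨_ | _, i⟩ := x <;> simp [succ]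

theorem succ_ne (x : Bool × ZMod n) : succ x ≠ x := by
  intro h
  simpa using congrArg Prod.fst h

theorem succ_succ_succ_ne (x : Bool × ZMod n) : succ (succ (succ x)) ≠ x := by
  intro h
  simpa using congrArg Prod.fst h

theorem one_ne_zero_of_three_le (hn : 3 ≤ n) : (1 : ZMod n) ≠ 0 := by
  have : Fact (1 < n) := ⟨by omega⟩
  exact one_ne_zero

theorem succ_succ_ne (hn : 3 ≤ n) (x : Bool × ZMod n) : succ (succ x) ≠ x := by
  intro h
  rw [succ_succ] at h
  simpa [one_ne_zero_of_three_le hn] using congrArg Prod.snd h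

theorem succ_succ_succ_succ_ne (hn : 3 ≤ n) (x : Bool × ZMod n) :
    succ (succ (succ (succ x))) ≠ x := by
  intro h
  have h2 : x.2 + 1 + 1 = x.2 := by simpa using congrArg Prod.snd h
  have h3 : ((2 : ℕ) : ZMod n) = 0 := by
    push_cast
    linear_combination h2
  rw [ZMod.natCast_eq_zero_iff] at h3
  exact absurd (Nat.le_of_dvd (by norm_num) h3) (by omega)

/-- The antiprism is the square of the cycle `v_0, u_0, v_1, u_1, …`. -/
theorem accordion_one_adj (hn : 3 ≤ n) (x y : Bool × ZMod n) : (accordion n 1).Adj x y ↔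
    y = succ x ∨ y = succ (succ x) ∨ succ y = x ∨ succ (succ y) = x := by
  have h1 := succ_ne x
  have h2 := succ_succ_ne hn x
  rw [succ_succ] at *
  rw [succ_succ]
  obtain ⟨_ | _, i⟩ := x <;> obtain ⟨_ | _, j⟩ := y <;>
    simp [accordion, succ] at * <;> grind

end Antiprism

open Antiprism in
/-- For every `n ≥ 3`, the antiprism `A_n = A[n,1]` has the PMH-property. -/
theorem antiprism_isPMH (n : ℕ) (hn : 3 ≤ n) : IsPMH (accordion n 1) := by
  intro M hM
  have : NeZero n := ⟨by omega⟩
  choose f hfM hfu using Subgraph.isPerfectMatching_iff.mp hM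
  have hf : ∀ x, f (f x) = x := fun x => (hfu _ _ (hfM x).symm).symm
  have hadj := fun x => (accordion_one_adj hn x (f x)).mp (hfM x).adj_sub
  have hinj := succ_injective (n := n)
  have h1 := succ_ne (n := n)
  have h2 := succ_succ_ne hn
  have h3 := succ_succ_succ_ne (n := n)
  have h4 := succ_succ_succ_succ_ne hn
  obtain ⟨⟨b, k⟩, hx⟩ : ∃ x, IsTransverse succ f x :=
    (isTransverse_or hinj hf hadj h1 h2 h3 h4 (true, 0)).elim (⟨_, ·⟩) (⟨_, ·⟩)
  let y : ℕ → Bool × ZMod n := fun j => (b, k + j)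
  have hy : ∀ j, y (j + 1) = succ (succ (y j)) := fun j => by simp [y, add_assoc]
  have hT : ∀ j, IsTransverse succ f (y j) := by
    intro j
    induction j with
    | zero => simpa [y] using hx
    | succ j ih => exact hy j ▸ ih.next hinj hf hadj h1 h2 h3 h4
  refine exists_isHamiltonianCycle_of_alternating M (f := f) (n := n)
    (τ := fun x => if x.1 = b then succ x else pred x)
    (L := fun j => if f (y j) = succ (succ (y j)) then succ (y j) else y j)
    (R := fun j => if f (y j) = succ (succ (y j)) then y j else succ (y j))
    hn (by simp [ZMod.card]) (fun a c => ⟨hfu a c, fun h => h ▸ hfM a⟩) ?_ ?_ ?_ ?_ ?_ ?_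
  · intro a
    by_cases h : a.1 = b <;> grind [succ_pred, pred_succ, fst_succ, fst_pred]
  · intro a
    rw [accordion_one_adj hn]
    split_ifs
    · exact .inl rfl
    · exact .inr (.inr (.inl (succ_pred a)))
  · intro j
    have : (y j).1 = b := rfl
    split_ifs <;> simp_all
  · intro j
    have hj := hT (j + 1)
    simp only [hy] at hj ⊢
    exact (hT j).apply_right_eq_left hf h3 h4 hj
  · have : y n = y 0 := by simp [y]
    simp only [this]
  · intro v
    suffices h : ∃ j < n, v = y j ∨ v = succ (y j) by
      obtain ⟨j, hj, h⟩ := h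
      refine ⟨j, hj, ?_⟩
      split_ifs
      exacts [h.symm, h]
    by_cases h : v.1 = b
    · refine ⟨(v.2 - k).val, ZMod.val_lt _, .inl ?_⟩
      ext <;> simp [y, h]
    · refine ⟨((pred v).2 - k).val, ZMod.val_lt _, .inr ?_⟩
      have : y ((pred v).2 - k).val = pred v := by
        ext <;> simp [y, Bool.eq_not.mpr (Ne.symm h)]
      rw [this, succ_pred]
end

section
/- For every integer n ≥ 3, the antiprism graph A_n = A[n,1] has the PH-property if and only if n ∈ {3, 4, 5, 6}. -/
open SimpleGraph

/-- A graph `G` has the PH-property if every pairing `M` of `G` (a perfect matching of the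
complete graph `⊤` on the vertex set of `G`) extends to a Hamiltonian cycle of `K_G`, i.e.
there is a perfect matching `N` of `G` such that `M ∪ N` is the edge set of a Hamiltonian
cycle of the complete graph on the vertices of `G`. -/
def IsPH {V : Type} [DecidableEq V] (G : SimpleGraph V) : Prop :=
  ∀ M : (⊤ : SimpleGraph V).Subgraph, M.IsPerfectMatching →
    ∃ N : G.Subgraph, N.IsPerfectMatching ∧
      ∃ (v : V) (c : (⊤ : SimpleGraph V).Walk v v), c.IsHamiltonianCycle ∧
        {e | e ∈ c.edges} = M.edgeSet ∪ N.edgeSet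

section PerfectMatching

variable {V : Type*} {G : SimpleGraph V}

/-- The subgraph whose edges join every vertex to its image under an involution. -/
def involutionSubgraph (G : SimpleGraph V) (p : V → V) (hp : Function.Involutive p)
    (hG : ∀ x, G.Adj x (p x)) : G.Subgraph where
  verts := Set.univ
  Adj x y := p x = y
  adj_sub := by rintro x y rfl; exact hG x
  edge_vert _ := Set.mem_univ _
  symm := ⟨by rintro x y rfl; exact hp x⟩

theorem involutionSubgraph_isPerfectMatching (p : V → V) (hp : Function.Involutive p)
    (hG : ∀ x, G.Adj x (p x)) : (involutionSubgraph G p hp hG).IsPerfectMatching :=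
  Subgraph.isPerfectMatching_iff.2 fun x => ⟨p x, rfl, fun _ h => Eq.symm h⟩

theorem exists_involution_of_isPerfectMatching {M : G.Subgraph} (hM : M.IsPerfectMatching) :
    ∃ m : V → V, Function.Involutive m ∧ ∀ x y, M.Adj x y ↔ m x = y := by
  choose m hm hu using Subgraph.isPerfectMatching_iff.1 hM
  refine ⟨m, fun x => (hu _ _ (hm x).symm).symm, fun x y => ⟨fun h => (hu x y h).symm, ?_⟩⟩
  rintro rfl
  exact hm x

end PerfectMatching

section HamiltonianCycle

variable {V : Type*}

theorem exists_walk_of_seq {G : SimpleGraph V} (w : ℕ → V) (k : ℕ)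
    (h : ∀ i < k, G.Adj (w i) (w (i + 1))) :
    ∃ p : G.Walk (w 0) (w k), p.support = (List.range (k + 1)).map w ∧
      p.edges = (List.range k).map fun i => s(w i, w (i + 1)) := by
  induction k with
  | zero => exact ⟨.nil, by simp, by simp⟩
  | succ k ih =>
    obtain ⟨p, hs, he⟩ := ih fun i hi => h i (by omega)
    refine ⟨p.concat (h k (by omega)), ?_, ?_⟩
    · rw [Walk.support_concat, hs, List.range_succ (n := k + 1)]; simp
    · rw [Walk.edges_concat, he, List.range_succ (n := k)]; simp

theorem exists_isHamiltonianCycle_of_seq [DecidableEq V] (w : ℕ → V) (k : ℕ) (hk : 3 ≤ k)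
    (hinj : Set.InjOn w (Set.Iio k)) (hsurj : ∀ v, ∃ i < k, w i = v) (h0 : w k = w 0) :
    ∃ (v : V) (c : (⊤ : SimpleGraph V).Walk v v), c.IsHamiltonianCycle ∧
      {e | e ∈ c.edges} = {e | ∃ i < k, e = s(w i, w (i + 1))} := by
  obtain ⟨k, rfl⟩ : ∃ l, k = l + 1 := ⟨k - 1, by omega⟩
  have hne : ∀ i < k + 1, ∀ j < k + 1, w i = w j → i = j := fun i hi j hj h => hinj hi hj h
  obtain ⟨p, hs, he⟩ := exists_walk_of_seq (G := ⊤) w k fun i hi h => by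
    have := hne i (by omega) (i + 1) (by omega) h
    omega
  have hadj : (⊤ : SimpleGraph V).Adj (w k) (w 0) := fun h => by
    have := hne k (by omega) 0 (by omega) h
    omega
  have hnd : p.support.Nodup := by
    rw [hs]
    exact List.Nodup.map_on (fun x hx y hy h =>
      hne x (List.mem_range.1 hx) y (List.mem_range.1 hy) h) List.nodup_range
  refine ⟨w k, .cons hadj p, ?_, ?_⟩
  · rw [Walk.isHamiltonianCycle_iff_isCycle_and_support_count_tail_eq_one]
    refine ⟨(Walk.cons_isCycle_iff _ _).2 ⟨(Walk.isPath_def _).2 hnd, ?_⟩, fun v => ?_⟩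
    · rw [he, List.mem_map]
      rintro ⟨i, hi, h⟩
      have hi := List.mem_range.1 hi
      rcases Sym2.eq_iff.1 h with ⟨h1, h2⟩ | ⟨h1, h2⟩
      · have := hne _ (by omega) _ (by omega) h1
        omega
      · have := hne _ (by omega) _ (by omega) h1
        have := hne _ (by omega) _ (by omega) h2
        omega
    · obtain ⟨i, hi, rfl⟩ := hsurj v
      simp only [Walk.support_cons, List.tail_cons]
      exact List.count_eq_one_of_mem hnd
        (by rw [hs]; exact List.mem_map.2 ⟨i, by simpa using hi, rfl⟩)
  · ext e
    simp only [Walk.edges_cons, he, List.mem_cons, List.mem_map, List.mem_range, Set.mem_ofPred_eq]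
    constructor
    · rintro (rfl | ⟨i, hi, rfl⟩)
      · exact ⟨k, by omega, by rw [h0]⟩
      · exact ⟨i, by omega, rfl⟩
    · rintro ⟨i, hi, rfl⟩
      rcases Nat.lt_succ_iff_lt_or_eq.1 hi with hi | rfl
      · exact .inr ⟨i, hi, rfl⟩
      · exact .inl (by rw [h0])

/-- The sequence obtained from `x` by applying `m` and `p` alternately, starting with `m`. -/
def alternatingSeq (m p : V → V) (x : V) : ℕ → V
  | 0 => x
  | i + 1 => if i % 2 = 0 then m (alternatingSeq m p x i) else p (alternatingSeq m p x i)

theorem alternatingSeq_two_mul (m p : V → V) (x : V) (k : ℕ) :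
    alternatingSeq m p x (2 * k) = (p ∘ m)^[k] x := by
  induction k with
  | zero => rfl
  | succ k ih =>
    rw [Function.iterate_succ_apply', ← ih, Nat.mul_succ]
    simp [alternatingSeq, Nat.add_mod]

theorem alternatingSeq_injOn {m p : V → V} (hm : Function.Involutive m)
    (hp : Function.Involutive p) (hm' : ∀ x, m x ≠ x) (hp' : ∀ x, p x ≠ x) {x : V} {n : ℕ}
    (hx : ∀ k, 0 < k → k < n → (p ∘ m)^[k] x ≠ x) :
    Set.InjOn (alternatingSeq m p x) (Set.Iio (2 * n)) := by
  set w := alternatingSeq m p x with hw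
  have hstep : ∀ i, w (i + 1) = if i % 2 = 0 then m (w i) else p (w i) := fun i => rfl
  have heven : ∀ t a, 0 < t → t < n → w a ≠ w (a + 2 * t) := by
    intro t a ht htn
    induction a with
    | zero =>
      intro h
      rw [zero_add, hw, alternatingSeq_two_mul] at h
      exact hx t ht htn h.symm
    | succ a ih =>
      intro h
      rw [show a + 1 + 2 * t = a + 2 * t + 1 by ring, hstep, hstep,
        show (a + 2 * t) % 2 = a % 2 by omega] at h
      split_ifs at h
      · exact ih (hm.injective h)
      · exact ih (hp.injective h)
  have hodd : ∀ t a, w a ≠ w (a + (2 * t + 1)) := by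
    intro t
    induction t with
    | zero =>
      intro a h
      rw [mul_zero, zero_add, hstep] at h
      split_ifs at h
      · exact hm' _ h.symm
      · exact hp' _ h.symm
    | succ t ih =>
      intro a h
      apply ih (a + 1)
      rw [show a + (2 * (t + 1) + 1) = a + 1 + (2 * t + 1) + 1 by ring, hstep,
        show (a + 1 + (2 * t + 1)) % 2 = a % 2 by omega] at h
      rw [hstep, h]
      split_ifs
      · exact hm _
      · exact hp _
  have hlt : ∀ a b, a < b → b < 2 * n → w a ≠ w b := by
    intro a b hab hb
    obtain ⟨t, ht | ht⟩ := Nat.even_or_odd' (b - a)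
    · rw [show b = a + 2 * t by omega]
      exact heven t a (by omega) (by omega)
    · rw [show b = a + (2 * t + 1) by omega]
      exact hodd t a
  intro a ha b hb h
  rcases lt_trichotomy a b with hab | hab | hab
  · exact absurd h (hlt a b hab hb)
  · exact hab
  · exact absurd h.symm (hlt b a hab ha)

theorem exists_isHamiltonianCycle_of_orbit [DecidableEq V] [Fintype V] {G : SimpleGraph V}
    {M : (⊤ : SimpleGraph V).Subgraph} {N : G.Subgraph} {m p : V → V}
    (hm : Function.Involutive m) (hp : Function.Involutive p)
    (hM : ∀ x y, M.Adj x y ↔ m x = y) (hN : ∀ x y, N.Adj x y ↔ p x = y) {n : ℕ} (hn : 2 ≤ n)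
    (hcard : Fintype.card V = 2 * n) {x : V} (hx : (p ∘ m)^[n] x = x)
    (hx' : ∀ k, 0 < k → k < n → (p ∘ m)^[k] x ≠ x) :
    ∃ (v : V) (c : (⊤ : SimpleGraph V).Walk v v), c.IsHamiltonianCycle ∧
      {e | e ∈ c.edges} = M.edgeSet ∪ N.edgeSet := by
  have hinj := alternatingSeq_injOn hm hp (fun y h => (M.adj_sub ((hM y _).2 rfl)).ne h.symm)
    (fun y h => (N.adj_sub ((hN y _).2 rfl)).ne h.symm) hx'
  have h0 : alternatingSeq m p x (2 * n) = alternatingSeq m p x 0 := by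
    rw [alternatingSeq_two_mul, hx]; rfl
  set w := alternatingSeq m p x
  have hstep : ∀ i, w (i + 1) = if i % 2 = 0 then m (w i) else p (w i) := fun i => rfl
  have hsurj : ∀ v, ∃ i < 2 * n, w i = v := by
    have hb : Function.Bijective fun i : Fin (2 * n) => w i :=
      (Fintype.bijective_iff_injective_and_card _).2
        ⟨fun i j h => Fin.ext (hinj i.2 j.2 h), by simp [hcard]⟩
    intro v
    obtain ⟨i, hi⟩ := hb.2 v
    exact ⟨i, i.2, hi⟩
  obtain ⟨v, c, hc, he⟩ := exists_isHamiltonianCycle_of_seq w (2 * n) (by omega) hinj hsurj h0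
  refine ⟨v, c, hc, he.trans ?_⟩
  ext e
  induction e with | _ a b
  simp only [Set.mem_ofPred_eq, Set.mem_union, Subgraph.mem_edgeSet]
  constructor
  · rintro ⟨i, -, hi⟩
    rw [← Subgraph.mem_edgeSet, ← Subgraph.mem_edgeSet, hi, Subgraph.mem_edgeSet,
      Subgraph.mem_edgeSet, hM, hN, hstep]
    split_ifs <;> simp
  · rw [hM, hN]
    obtain ⟨j, hj, rfl⟩ := hsurj a
    rintro (rfl | rfl) <;> rcases Nat.even_or_odd' j with ⟨t, rfl | rfl⟩
    · exact ⟨2 * t, hj, by rw [hstep, if_pos (by omega)]⟩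
    · exact ⟨2 * t, by omega, by rw [hstep, if_pos (by omega), hm, Sym2.eq_swap]⟩
    · rcases t with _ | t
      · refine ⟨2 * n - 1, by omega, ?_⟩
        have := hstep (2 * n - 1)
        rw [if_neg (by omega), show 2 * n - 1 + 1 = 2 * n by omega, h0] at this
        rw [show 2 * n - 1 + 1 = 2 * n by omega, h0, mul_zero, Sym2.eq_swap]
        conv_lhs => rw [this, hp]
        conv_rhs => rw [this]
      · exact ⟨2 * t + 1, by omega, by
          rw [show 2 * (t + 1) = 2 * t + 1 + 1 by ring, hstep (2 * t + 1), if_neg (by omega), hp,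
            Sym2.eq_swap]⟩
    · exact ⟨2 * t + 1, hj, by rw [hstep (2 * t + 1), if_neg (by omega)]⟩

theorem eq_univ_of_isHamiltonianCycle [DecidableEq V] {G : SimpleGraph V} {v : V}
    {c : G.Walk v v} (hc : c.IsHamiltonianCycle) {S : Set V} (hS : S.Nonempty)
    (h : ∀ x y, s(x, y) ∈ c.edges → x ∈ S → y ∈ S) : S = Set.univ := by
  have key : ∀ {a b : V} (p : G.Walk a b), (∀ e ∈ p.edges, e ∈ c.edges) →
      ∀ y ∈ p.support, (a ∈ S ↔ y ∈ S) := by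
    intro a b p
    induction p with
    | nil => simp
    | @cons a a' b hadj p ih =>
      intro he y hy
      rw [Walk.support_cons, List.mem_cons] at hy
      have haa : s(a, a') ∈ c.edges := he _ (by simp)
      rcases hy with rfl | hy
      · rfl
      · rw [← ih (fun e h => he e (by simp [h])) y hy]
        exact ⟨h _ _ haa, h _ _ (by rwa [Sym2.eq_swap])⟩
  obtain ⟨x, hx⟩ := hS
  have hv := (key c (fun _ => id) x (hc.mem_support x)).2 hx
  exact Set.eq_univ_of_forall fun y => (key c (fun _ => id) y (hc.mem_support y)).1 hv

end HamiltonianCycle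

section Position

/-- The vertices of an antiprism in the order `v_0, u_0, v_1, u_1, …`, in which two vertices are
adjacent exactly when they are at cyclic distance `1` or `2`. -/
def pos (n : ℕ) (x : ℤ) : Bool × ZMod n := (decide (x % 2 = 0), ((x / 2 : ℤ) : ZMod n))

theorem pos_eq_iff {n : ℕ} {x y : ℤ} : pos n x = pos n y ↔ (2 * n : ℤ) ∣ x - y := by
  rw [pos, pos, Prod.mk.injEq, decide_eq_decide, ZMod.intCast_eq_intCast_iff_dvd_sub]
  constructor
  · rintro ⟨h, k, hk⟩
    refine ⟨-k, ?_⟩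
    rw [mul_assoc, mul_neg, ← hk]
    omega
  · rintro ⟨k, hk⟩
    rw [mul_assoc] at hk
    refine ⟨by omega, -k, ?_⟩
    rw [mul_neg]
    omega

theorem pos_add_self (n : ℕ) (x : ℤ) : pos n (x + 2 * n) = pos n x :=
  pos_eq_iff.2 ⟨1, by ring⟩

theorem eq_of_pos_eq {n : ℕ} {x y : ℤ} (h : pos n x = pos n y) (h1 : x - y < 2 * n)
    (h2 : y - x < 2 * n) : x = y := by
  have := Int.eq_zero_of_abs_lt_dvd (pos_eq_iff.1 h) (abs_lt.2 ⟨by omega, h1⟩)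
  omega

theorem exists_pos_eq {n : ℕ} [NeZero n] (v : Bool × ZMod n) :
    ∃ x : ℕ, x < 2 * n ∧ pos n x = v := by
  obtain ⟨b, i⟩ := v
  have hi := ZMod.val_lt i
  cases b
  · refine ⟨2 * i.val + 1, by omega, Prod.ext ?_ ?_⟩
    · simp only [pos, decide_eq_false_iff_not]; omega
    · rw [pos, show ((2 * i.val + 1 : ℕ) : ℤ) / 2 = (i.val : ℤ) by omega]; simp
  · refine ⟨2 * i.val, by omega, Prod.ext ?_ ?_⟩
    · simp only [pos, decide_eq_true_eq]; omega
    · rw [pos, show ((2 * i.val : ℕ) : ℤ) / 2 = (i.val : ℤ) by omega]; simp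

theorem pos_eq_mk {n : ℕ} {x : ℤ} {b : Bool} {i : ZMod n} (hb : decide (x % 2 = 0) = b)
    (hi : ((x / 2 : ℤ) : ZMod n) = i) : pos n x = (b, i) :=
  Prod.ext hb hi

theorem adj_pos_add_two {n : ℕ} (hn : 3 ≤ n) (x : ℤ) :
    (accordion n 1).Adj (pos n x) (pos n (x + 2)) := by
  refine (SimpleGraph.fromRel_adj _ _ _).2 ⟨fun h => ?_, .inl (.inl ⟨?_, ?_⟩)⟩
  · have := eq_of_pos_eq h (by omega) (by omega)
    omega
  · simp [pos]
  · simp only [pos]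
    rw [show (x + 2) / 2 = x / 2 + 1 by omega]
    push_cast
    rfl

theorem adj_pos_add_one {n : ℕ} (hn : 3 ≤ n) (x : ℤ) :
    (accordion n 1).Adj (pos n x) (pos n (x + 1)) := by
  refine (SimpleGraph.fromRel_adj _ _ _).2 ⟨fun h => ?_, ?_⟩
  · have := eq_of_pos_eq h (by omega) (by omega)
    omega
  · rcases Int.emod_two_eq_zero_or_one x with h | h
    · refine .inr (.inr ⟨?_, ?_, .inl ?_⟩) <;> simp only [pos]
      · simp; omega
      · simp; omega
      · rw [show (x + 1) / 2 = x / 2 by omega]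
    · refine .inl (.inr ⟨?_, ?_, .inr ?_⟩) <;> simp only [pos]
      · simp; omega
      · simp; omega
      · rw [show (x + 1) / 2 = x / 2 + 1 by omega]; push_cast; rfl

theorem adj_pos_of_dvd {n : ℕ} (hn : 3 ≤ n) {x y d : ℤ} (h : (2 * n : ℤ) ∣ x + d - y)
    (hd : d = 1 ∨ d = 2 ∨ d = -1 ∨ d = -2) : (accordion n 1).Adj (pos n x) (pos n y) := by
  rw [← pos_eq_iff.2 h]
  rcases hd with rfl | rfl | rfl | rfl
  · exact adj_pos_add_one hn x
  · exact adj_pos_add_two hn x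
  · simpa using (adj_pos_add_one hn (x + -1)).symm
  · simpa using (adj_pos_add_two hn (x + -2)).symm

theorem exists_of_adj_pos {n : ℕ} {x : ℤ} {v : Bool × ZMod n}
    (h : (accordion n 1).Adj (pos n x) v) :
    ∃ d : ℤ, (d = 1 ∨ d = 2 ∨ d = -1 ∨ d = -2) ∧ v = pos n (x + d) := by
  obtain ⟨b, i⟩ := v
  rcases ((SimpleGraph.fromRel_adj _ _ _).1 h).2 with
    (⟨h1, h2⟩ | ⟨h1, h2, h3 | h3⟩) | (⟨h1, h2⟩ | ⟨h1, h2, h3 | h3⟩) <;>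
    simp only [pos] at h1 h2
  · refine ⟨2, by simp, (pos_eq_mk (by simpa using h1) ?_).symm⟩
    rw [h2, show (x + 2) / 2 = x / 2 + 1 by omega]; push_cast; rfl
  · have hx : x % 2 = 1 := by simpa using h1
    refine ⟨-1, by simp, (pos_eq_mk (by simp [h2]; omega) ?_).symm⟩
    simp only [pos] at h3
    rw [h3, show (x + -1) / 2 = x / 2 by omega]
  · have hx : x % 2 = 1 := by simpa using h1
    refine ⟨1, by simp, (pos_eq_mk (by simp [h2]; omega) ?_).symm⟩
    simp only [pos] at h3
    rw [h3, show (x + 1) / 2 = x / 2 + 1 by omega]; push_cast; rfl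
  · refine ⟨-2, by simp, (pos_eq_mk ?_ ?_).symm⟩
    · rw [h1, decide_eq_decide]; omega
    · rw [show (x + -2) / 2 = x / 2 - 1 by omega]; push_cast; rw [h2]; ring
  · have hx : x % 2 = 0 := by simpa using h2
    refine ⟨1, by simp, (pos_eq_mk (by simp [h1]; omega) ?_).symm⟩
    simp only [pos] at h3
    rw [← h3, show (x + 1) / 2 = x / 2 by omega]
  · have hx : x % 2 = 0 := by simpa using h2
    refine ⟨-1, by simp, (pos_eq_mk (by simp [h1]; omega) ?_).symm⟩
    simp only [pos] at h3
    rw [show (x + -1) / 2 = x / 2 - 1 by omega]; push_cast; rw [h3]; simp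

end Position

section NotPH

theorem right_gap {d : ℤ → ℤ} (hd : ∀ x, d x = 1 ∨ d x = 2 ∨ d x = -1 ∨ d x = -2)
    (hinv : ∀ x, d (x + d x) = -d x) (h1 : ∀ x, x = 1 ∨ x = 3 ∨ x = 5 → d x ≠ 1)
    (h2 : ∀ x, x = 1 ∨ x = 3 → ¬(d x = 2 ∧ d (x + 1) = 2)) :
    d 1 < 0 ∧ 0 < d 2 ∨ d 1 = 2 ∧ d 2 = -2 := by
  have e : ∀ x k, d x = k → d (x + k) = -k := fun x k h => h ▸ hinv x
  have a1 := h1 1 (by simp)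
  have a3 := h1 3 (by simp)
  have a5 := h1 5 (by simp)
  have b1 := h2 1 (by simp)
  have b3 := h2 3 (by simp)
  have i1 := e 1 2
  have i2 := e 2 1
  have i2' := e 2 2
  have i2'' := e 2 (-1)
  have i3 := e 3 (-1)
  have i3' := e 3 (-2)
  have i3'' := e 3 2
  have i4 := e 4 (-2)
  have i4' := e 4 (-1)
  have i4'' := e 4 1
  have i4''' := e 4 2
  norm_num at b1 b3 i1 i2 i2' i2'' i3 i3' i3'' i4 i4' i4'' i4'''
  have k2 := hd 2
  have k3 := hd 3
  have k4 := hd 4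
  rcases hd 1 with k1 | k1 | k1 | k1 <;> grind

theorem no_displacement {d : ℤ → ℤ} (hd : ∀ x, d x = 1 ∨ d x = 2 ∨ d x = -1 ∨ d x = -2)
    (hinv : ∀ x, d (x + d x) = -d x)
    (h1 : ∀ x, x = 1 ∨ x = 3 ∨ x = 5 ∨ x = -2 ∨ x = -4 ∨ x = -6 → d x ≠ 1)
    (h2 : ∀ x, x = 1 ∨ x = 3 ∨ x = -4 ∨ x = -6 → ¬(d x = 2 ∧ d (x + 1) = 2)) : False := by
  have e : ∀ x k, d x = k → d (x + k) = -k := fun x k h => h ▸ hinv x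
  have hr := right_gap hd hinv (fun x hx => h1 x (by omega)) (fun x hx => h2 x (by omega))
  have hl := right_gap (d := fun x => -d (-x)) (fun x => by have := hd (-x); omega)
    (fun x => by
      have := hinv (-x)
      rw [show -(x + -d (-x)) = -x + d (-x) by ring, this])
    (fun x hx h => by
      have := e (-x) (-1) (by omega)
      exact h1 (-x + -1) (by omega) (by omega))
    (fun x hx ⟨h, h'⟩ => by
      have i := e (-x) (-2) (by omega)
      have i' := e (-(x + 1)) (-2) (by omega)
      refine h2 (-x + -3) (by omega) ⟨?_, ?_⟩
      · rw [show -x + -3 = -(x + 1) + -2 by ring]; omega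
      · rw [show -x + -3 + 1 = -x + -2 by ring]; omega)
  have i0 := e 0 1
  have i0' := e 0 2
  have i0'' := e 0 (-1)
  have i0''' := e 0 (-2)
  have i1 := e 1 (-1)
  have i1' := e 1 (-2)
  have i2 := e 2 (-2)
  have j1 := e (-1) 1
  have j1' := e (-1) 2
  have j2 := e (-2) 2
  norm_num at i0 i0' i0'' i0''' i1 i1' i2 j1 j1' j2 hl
  have k1 := hd 1
  have k2 := hd (-1)
  rcases hd 0 with k0 | k0 | k0 | k0 <;> omega

/-- The pairing `0–7`, `1–2`, `3–4`, `5–6`, `8–9`, `10–11`, …. -/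
def badMate (x : ℕ) : ℕ :=
  if x = 0 then 7 else if x = 7 then 0 else
  if x < 7 then (if x % 2 = 1 then x + 1 else x - 1) else (if x % 2 = 0 then x + 1 else x - 1)

theorem badMate_badMate (x : ℕ) : badMate (badMate x) = x := by
  grind [badMate]

theorem badMate_ne (x : ℕ) : badMate x ≠ x := by
  unfold badMate; split_ifs <;> omega

theorem badMate_lt {n x : ℕ} (hn : 7 ≤ n) (hx : x < 2 * n) : badMate x < 2 * n := by
  unfold badMate; split_ifs <;> omega

theorem not_isPH_of_seven_le {n : ℕ} (hn : 7 ≤ n) : ¬IsPH (accordion n 1) := by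
  intro h
  have : NeZero n := ⟨by omega⟩
  choose idx hlt hpos using exists_pos_eq (n := n)
  have hidx : ∀ x : ℕ, x < 2 * n → idx (pos n x) = x := fun x hx => by
    have := hlt (pos n x)
    exact_mod_cast eq_of_pos_eq (hpos (pos n x)) (by omega) (by omega)
  obtain ⟨m, hm_def⟩ : ∃ m : Bool × ZMod n → Bool × ZMod n,
    ∀ v, m v = pos n (badMate (idx v)) := ⟨_, fun _ => rfl⟩
  have hm : Function.Involutive m := fun v => by
    rw [hm_def (m v), hm_def v, hidx _ (badMate_lt hn (hlt v)), badMate_badMate, hpos]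
  have hm_ne : ∀ v, m v ≠ v := fun v hv => by
    have := congrArg idx hv
    rw [hm_def, hidx _ (badMate_lt hn (hlt v))] at this
    exact badMate_ne _ this
  have hm_nat : ∀ x : ℕ, x < 2 * n → m (pos n x) = pos n (badMate x) := fun x hx => by
    rw [hm_def, hidx x hx]
  have hm_pair : ∀ x : ℤ, x = 1 ∨ x = 3 ∨ x = 5 ∨ x = -2 ∨ x = -4 ∨ x = -6 →
      m (pos n x) = pos n (x + 1) := by
    intro x hx
    by_cases h0 : 0 ≤ x
    · lift x to ℕ using h0
      have hx' : x = 1 ∨ x = 3 ∨ x = 5 := by omega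
      rw [hm_nat x (by omega)]
      rcases hx' with rfl | rfl | rfl <;> rfl
    · obtain ⟨y, hy⟩ : ∃ y : ℕ, (y : ℤ) = x + 2 * n := ⟨(x + 2 * n).toNat, by omega⟩
      rw [← pos_add_self n x, ← hy, hm_nat y (by omega), ← pos_add_self n (x + 1)]
      refine congrArg (pos n) ?_
      unfold badMate; split_ifs <;> omega
  obtain ⟨N, hN, v, c, hc, he⟩ := h (involutionSubgraph ⊤ m hm fun x => (hm_ne x).symm)
    (involutionSubgraph_isPerfectMatching _ _ _)
  obtain ⟨p, hp, hNp⟩ := exists_involution_of_isPerfectMatching hN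
  have hclosed : ∀ S : Set (Bool × ZMod n), S.Nonempty → (∀ x ∈ S, m x ∈ S) →
      (∀ x ∈ S, p x ∈ S) → S = Set.univ := by
    intro S hS hSm hSp
    refine eq_univ_of_isHamiltonianCycle hc hS fun x y hxy hx => ?_
    have hxy : s(x, y) ∈ {e | e ∈ c.edges} := hxy
    rw [he] at hxy
    rcases hxy with hxy | hxy
    · exact (show m x = y from hxy) ▸ hSm x hx
    · exact (hNp x y).1 hxy ▸ hSp x hx
  choose d hd hpd using fun x : ℤ => exists_of_adj_pos (N.adj_sub ((hNp (pos n x) _).2 rfl))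
  have hinv : ∀ x, d (x + d x) = -d x := fun x => by
    have h := hp (pos n x)
    rw [hpd, hpd] at h
    have h1 := hd x
    have h2 := hd (x + d x)
    have := eq_of_pos_eq h (by omega) (by omega)
    omega
  have e : ∀ x k, d x = k → p (pos n x) = pos n (x + k) ∧ p (pos n (x + k)) = pos n x :=
    fun x k h => by
      have := hpd x
      rw [h] at this
      exact ⟨this, by rw [← this, hp]⟩
  refine no_displacement hd hinv (fun x hx hdx => ?_) (fun x hx ⟨hdx, hdx'⟩ => ?_)
  · have hmx := hm_pair x hx
    have hmx' : m (pos n (x + 1)) = pos n x := by rw [← hmx, hm]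
    obtain ⟨e1, e2⟩ := e x 1 hdx
    have hS := hclosed {pos n x, pos n (x + 1)} (by simp) (by simp [hmx, hmx'])
      (by simp [e1, e2])
    have : pos n (x + 2) ∈ ({pos n x, pos n (x + 1)} : Set _) := hS ▸ Set.mem_univ _
    rcases this with h | h <;> have := eq_of_pos_eq h (by omega) (by omega) <;> omega
  · have hmx := hm_pair x (by omega)
    have hmx' : m (pos n (x + 1)) = pos n x := by rw [← hmx, hm]
    have hmy := hm_pair (x + 2) (by omega)
    have hmy' : m (pos n (x + 2 + 1)) = pos n (x + 2) := by rw [← hmy, hm]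
    obtain ⟨e1, e2⟩ := e x 2 hdx
    obtain ⟨e3, e4⟩ := e (x + 1) 2 hdx'
    rw [show x + 1 + 2 = x + 2 + 1 by ring] at e3 e4
    have hS := hclosed {pos n x, pos n (x + 1), pos n (x + 2), pos n (x + 2 + 1)} (by simp)
      (by simp [hmx, hmx', hmy, hmy']) (by simp [e1, e2, e3, e4])
    have : pos n (x + 4) ∈
        ({pos n x, pos n (x + 1), pos n (x + 2), pos n (x + 2 + 1)} : Set _) :=
      hS ▸ Set.mem_univ _
    rcases this with h | h | h | h <;> have := eq_of_pos_eq h (by omega) (by omega) <;> omega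

end NotPH

section Codes

/-- The `x`-th hexadecimal digit of `c`. -/
def digit (c x : ℕ) : ℕ := Nat.mod (Nat.div c (Nat.pow 16 x)) 16

theorem digit_sum (f : ℕ → ℕ) (hf : ∀ x, f x < 16) {k x : ℕ} (hx : x < k) :
    digit (∑ z ∈ Finset.range k, f z * 16 ^ z) x = f x := by
  change (∑ z ∈ Finset.range k, f z * 16 ^ z) / 16 ^ x % 16 = f x
  induction k generalizing f x with
  | zero => omega
  | succ k ih =>
    have hsum : ∑ z ∈ Finset.range (k + 1), f z * 16 ^ z =
        16 * (∑ z ∈ Finset.range k, f (z + 1) * 16 ^ z) + f 0 := by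
      rw [Finset.sum_range_succ', Finset.mul_sum]
      congr 1
      · exact Finset.sum_congr rfl fun z _ => by ring
      · simp
    have h0 := hf 0
    rw [hsum]
    rcases x with _ | x
    · rw [pow_zero, Nat.div_one]; omega
    · rw [pow_succ', ← Nat.div_div_eq_div_mul,
        show ∀ t, (16 * t + f 0) / 16 = t from fun t => by omega]
      exact ih (fun z => f (z + 1)) (fun z => hf _) (by omega)

/-- Whether alternating between the pairings coded by `c` and `d` leads from `x` to `0` after `k`
rounds, and not earlier. -/
def reachesZero (c d k : ℕ) : ℕ → Bool :=
  Nat.rec (fun x => Nat.beq x 0)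
    (fun _ ih x => Bool.rec (ih (digit d (digit c x))) false (Nat.beq x 0)) k

theorem reachesZero_iff {c d k x : ℕ} : reachesZero c d k x = true ↔
    (digit d ∘ digit c)^[k] x = 0 ∧ ∀ j < k, (digit d ∘ digit c)^[j] x ≠ 0 := by
  induction k generalizing x with
  | zero => simp [reachesZero]
  | succ k ih =>
    have hrec : reachesZero c d (k + 1) x =
        Bool.rec (reachesZero c d k (digit d (digit c x))) false (Nat.beq x 0) := rfl
    rw [hrec]
    cases hx : Nat.beq x 0
    · rw [ih, Function.iterate_succ_apply]
      refine and_congr_right fun _ => ⟨fun h j hj => ?_, fun h j hj => ?_⟩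
      · rcases j with _ | j
        · exact Nat.ne_of_beq_eq_false hx
        · exact h j (by omega)
      · exact h (j + 1) (by omega)
    · simp only [Bool.false_eq_true, false_iff, not_and]
      exact fun _ h => h 0 (by omega) (Nat.eq_of_beq_eq_true hx)

/-- Whether one of the matchings coded by `ds` completes the pairing of `2 * (k + 1)` vertices coded
by `c` to a Hamiltonian cycle. -/
def extendsCode (k : ℕ) (ds : List ℕ) (c : ℕ) : Bool :=
  List.rec false
    (fun d _ ih => Bool.rec ih true (reachesZero c d k (digit d (digit c 0)))) ds

theorem exists_of_extendsCode {k : ℕ} {ds : List ℕ} {c : ℕ} (h : extendsCode k ds c = true) :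
    ∃ d ∈ ds, reachesZero c d k (digit d (digit c 0)) = true := by
  induction ds with
  | nil => cases h
  | cons d ds ih =>
    have hrec : extendsCode k (d :: ds) c =
      Bool.rec (extendsCode k ds c) true (reachesZero c d k (digit d (digit c 0))) := rfl
    cases hd : reachesZero c d k (digit d (digit c 0))
    · rw [hrec, hd] at h
      obtain ⟨d', hd', h'⟩ := ih h
      exact ⟨d', List.mem_cons_of_mem _ hd', h'⟩
    · exact ⟨d, List.mem_cons_self, hd⟩

/-- Whether `P` holds for the codes of all pairings obtained from the partial pairing coded by `c`
by pairing up the elements of the list. -/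
def checkPairings (P : ℕ → Bool) : ℕ → List ℕ → ℕ → Bool
  | _, [], c => P c
  | 0, _ :: _, _ => false
  | k + 1, x :: l, c => l.all fun y => checkPairings P k (l.erase y)
      (Nat.add c (Nat.add (Nat.mul y (Nat.pow 16 x)) (Nat.mul x (Nat.pow 16 y))))

theorem checkPairings_sound {P : ℕ → Bool} {m : ℕ → ℕ} {k : ℕ} {l : List ℕ} {c : ℕ}
    (h : checkPairings P k l c = true) (hl : l.Nodup) (hmem : ∀ x ∈ l, m x ∈ l)
    (hinv : ∀ x ∈ l, m (m x) = x) (hne : ∀ x ∈ l, m x ≠ x) :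
    P (c + (l.map fun x => m x * 16 ^ x).sum) = true := by
  induction k generalizing l c with
  | zero =>
    cases l with
    | nil => simpa [checkPairings] using h
    | cons x l => cases h
  | succ k ih =>
    cases l with
    | nil => simpa [checkPairings] using h
    | cons x l =>
      have hx : m x ∈ l := (List.mem_cons.1 (hmem x (by simp))).resolve_left (hne x (by simp))
      have hnd := List.nodup_cons.1 hl
      have hsub : ∀ z ∈ l.erase (m x), z ∈ x :: l := fun z hz =>
        List.mem_cons_of_mem _ (List.mem_of_mem_erase hz)
      have h' := ih (List.all_eq_true.1 h _ hx) (hnd.2.erase _) (fun z hz => ?_)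
        (fun z hz => hinv z (hsub z hz)) (fun z hz => hne z (hsub z hz))
      · rw [List.map_cons, List.sum_cons, ← List.sum_map_erase _ hx, hinv x (by simp)]
        convert h' using 2
        simp only [Nat.add_eq, Nat.mul_eq, Nat.pow_eq]
        ring
      · obtain ⟨hz1, hz2⟩ := (hnd.2.mem_erase_iff).1 hz
        refine (hnd.2.mem_erase_iff).2 ⟨fun hzx => ?_, ?_⟩
        · have := congrArg m hzx
          rw [hinv z (hsub z hz), hinv x (by simp)] at this
          exact hnd.1 (this ▸ hz2)
        · refine (List.mem_cons.1 (hmem z (hsub z hz))).resolve_left fun hzx => hz1 ?_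
          rw [← hzx, hinv z (hsub z hz)]

/-- `d` codes a perfect matching of the antiprism with `2 * n` vertices. -/
def IsMatchingCode (n d : ℕ) : Prop :=
  ∀ x < 2 * n, digit d x < 2 * n ∧ digit d (digit d x) = x ∧
    (digit d x = x + 1 ∨ digit d x = x + 2 ∨ x = digit d x + 1 ∨ x = digit d x + 2 ∨
      digit d x + 2 * n = x + 1 ∨ digit d x + 2 * n = x + 2 ∨
      x + 2 * n = digit d x + 1 ∨ x + 2 * n = digit d x + 2)

instance (n d : ℕ) : Decidable (IsMatchingCode n d) := by
  unfold IsMatchingCode; infer_instance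

theorem IsMatchingCode.adj {n d x : ℕ} (hn : 3 ≤ n) (h : IsMatchingCode n d) (hx : x < 2 * n) :
    (accordion n 1).Adj (pos n x) (pos n (digit d x)) := by
  obtain ⟨-, -, h⟩ := h x hx
  rcases h with h | h | h | h | h | h | h | h
  · exact adj_pos_of_dvd hn (d := 1) ⟨0, by omega⟩ (by simp)
  · exact adj_pos_of_dvd hn (d := 2) ⟨0, by omega⟩ (by simp)
  · exact adj_pos_of_dvd hn (d := -1) ⟨0, by omega⟩ (by simp)
  · exact adj_pos_of_dvd hn (d := -2) ⟨0, by omega⟩ (by simp)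
  · exact adj_pos_of_dvd hn (d := 1) ⟨1, by omega⟩ (by simp)
  · exact adj_pos_of_dvd hn (d := 2) ⟨1, by omega⟩ (by simp)
  · exact adj_pos_of_dvd hn (d := -1) ⟨-1, by omega⟩ (by simp)
  · exact adj_pos_of_dvd hn (d := -2) ⟨-1, by omega⟩ (by simp)

theorem isPH_of_checkPairings {n : ℕ} (hn : 3 ≤ n) (hn' : n ≤ 8) (ds : List ℕ)
    (hds : ∀ d ∈ ds, IsMatchingCode n d)
    (h : checkPairings (extendsCode (n - 1) ds) (2 * n) (List.range (2 * n)) 0 = true) :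
    IsPH (accordion n 1) := by
  have : NeZero n := ⟨by omega⟩
  choose idx hlt hpos using exists_pos_eq (n := n)
  have hidx : ∀ x : ℕ, x < 2 * n → idx (pos n x) = x := fun x hx => by
    have := hlt (pos n x)
    exact_mod_cast eq_of_pos_eq (hpos (pos n x)) (by omega) (by omega)
  intro M hM
  obtain ⟨m, hm, hMm⟩ := exists_involution_of_isPerfectMatching hM
  have hcode := checkPairings_sound (m := fun x => idx (m (pos n x))) h List.nodup_range
    (fun x _ => List.mem_range.2 (hlt _)) (fun x hx => by
      simp only [hpos, hm (pos n x)]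
      exact hidx x (List.mem_range.1 hx))
    (fun x _ hx => (M.adj_sub ((hMm (pos n x) _).2 rfl)).ne (by
      rw [← hpos (m (pos n x)), hx]))
  rw [zero_add] at hcode
  obtain ⟨c, hc⟩ : ∃ c,
    c = ((List.range (2 * n)).map fun x : ℕ => idx (m (pos n x)) * 16 ^ x).sum := ⟨_, rfl⟩
  rw [← hc] at hcode
  have hcm : ∀ x : ℕ, x < 2 * n → digit c x = idx (m (pos n x)) := fun x hx =>
    hc ▸ digit_sum (fun x => idx (m (pos n x)))
      (fun y => (hlt (m (pos n y))).trans_le (by omega)) hx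
  obtain ⟨d, hd, hreach⟩ := exists_of_extendsCode hcode
  replace hd := hds d hd
  obtain ⟨p, hp_def⟩ : ∃ p : Bool × ZMod n → Bool × ZMod n,
    ∀ v, p v = pos n (digit d (idx v)) := ⟨_, fun _ => rfl⟩
  have hp : Function.Involutive p := fun v => by
    rw [hp_def (p v), hp_def v, hidx _ (hd _ (hlt v)).1, (hd _ (hlt v)).2.1, hpos]
  have hadj : ∀ v, (accordion n 1).Adj v (p v) := fun v => by
    have := hd.adj hn (hlt v)
    rwa [hpos, ← hp_def] at this
  have hiter : ∀ k, (digit d ∘ digit c)^[k] 0 < 2 * n ∧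
      pos n ((digit d ∘ digit c)^[k] 0 : ℕ) = (p ∘ m)^[k] (pos n 0) := by
    intro k
    induction k with
    | zero => exact ⟨by simp; omega, rfl⟩
    | succ k ih =>
      obtain ⟨ih1, ih2⟩ := ih
      rw [Function.iterate_succ_apply', Function.iterate_succ_apply', ← ih2,
        Function.comp_apply, Function.comp_apply, hcm _ ih1]
      exact ⟨(hd _ (hlt _)).1, (hp_def _).symm⟩
  obtain ⟨hz, hnz⟩ := reachesZero_iff.1 hreach
  refine ⟨involutionSubgraph _ p hp hadj, involutionSubgraph_isPerfectMatching _ _ _,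
    exists_isHamiltonianCycle_of_orbit hm hp hMm (fun _ _ => Iff.rfl) (n := n) (by omega)
      (by simp [ZMod.card]) (x := pos n 0) ?_ fun k hk hkn heq => ?_⟩
  · rw [← (hiter n).2, show n = n - 1 + 1 by omega, Function.iterate_succ_apply]
    exact congrArg _ (congrArg Nat.cast hz)
  · rw [← (hiter k).2] at heq
    refine hnz (k - 1) (by omega) ?_
    have h1 := (hiter k).1
    have h2 := eq_of_pos_eq heq (by omega) (by omega)
    rw [show k = k - 1 + 1 by omega, Function.iterate_succ_apply] at h2
    exact_mod_cast h2

end Codes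

/-- For `n ≥ 3`, the antiprism `A_n = A[n,1]` has the PH-property iff `n ∈ {3,4,5,6}`. -/
theorem antiprism_isPH_iff (n : ℕ) (hn : 3 ≤ n) :
    IsPH (accordion n 1) ↔ n = 3 ∨ n = 4 ∨ n = 5 ∨ n = 6 := by
  refine ⟨fun h => ?_, ?_⟩
  · by_contra hne
    exact not_isPH_of_seven_le (by omega) h
  · rintro (rfl | rfl | rfl | rfl)
    · exact isPH_of_checkPairings (by norm_num) (by norm_num)
        [4530945, 3298305, 4526130, 1261650] (by decide +kernel) (by decide +kernel)
    · exact isPH_of_checkPairings (by norm_num) (by norm_num)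
        [1732584193, 1417023538, 1731351553, 339103858, 90390823, 1349653558]
        (by decide +kernel) (by decide +kernel)
    · exact isPH_of_checkPairings (by norm_num) (by norm_num)
        [590143103745, 101022122130, 483522924840, 27253675065, 589827543090, 32302645545,
          70450828440, 483542570040, 70452061080, 590143098930, 101002399890, 509359576065]
        (by decide +kernel) (by decide +kernel)
    · exact isPH_of_checkPairings (by norm_num) (by norm_num)
        [188606631453441, 167926048362546, 18101545620666, 10615102062891, 26914771386546,
          10610053092411, 159117871567146, 167926362690561, 18182013592506, 188525849153586,
          188525849158401, 188606630220801, 18182329148346, 159112842395946, 28207268384946,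
          167926363923201, 9322585265211, 188606315897601, 26914751664306, 159117891212346]
        (by decide +kernel) (by decide +kernel)
end

section
/- For every integer n ≥ 7, the pairing M = {u_1 v_5, u_2 v_2, u_3 v_3, u_4 v_4} ∪ {u_i v_{i+1} : 5 ≤ i ≤ n} of the antiprism A_n = A[n,1] cannot be extended to a Hamiltonian cycle of K_{A_n}: there is no perfect matching N of A[n,1] such that M ∪ N is the edge set of a Hamiltonian cycle of the complete graph on the vertices of A[n,1]. In particular, A[n,1] does not have the PH-property for n ≥ 7. -/
open SimpleGraph

theorem SimpleGraph.Walk.mem_iff_of_mem_support {V : Type*} {G : SimpleGraph V} {S : Set V}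
    {a b : V} (w : G.Walk a b) (hS : ∀ x y, s(x, y) ∈ w.edges → x ∈ S → y ∈ S)
    {x : V} (hx : x ∈ w.support) : x ∈ S ↔ a ∈ S := by
  induction w with
  | nil => simp_all
  | @cons a c b h p ih =>
    have hac : c ∈ S ↔ a ∈ S :=
      ⟨hS c a (by simp [Sym2.eq_swap]), hS a c (by simp)⟩
    rw [Walk.support_cons, List.mem_cons] at hx
    rcases hx with rfl | hx
    · rfl
    · rw [ih (fun y z hyz => hS y z (by simp [hyz])) hx, hac]

theorem ZMod.natCast_inj_of_lt {n a b : ℕ} (h : (a : ZMod n) = b) (hab : a < b + n)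
    (hba : b < a + n) : a = b := by
  have h' := (Nat.modEq_iff_dvd.mp ((ZMod.natCast_eq_natCast_iff a b n).mp h))
  have := Int.eq_zero_of_abs_lt_dvd h' (by rw [abs_lt]; omega)
  omega

theorem ZMod.exists_natCast_eq {n : ℕ} (hn : 0 < n) (m : ℕ) (x : ZMod n) :
    ∃ k : ℕ, m ≤ k ∧ k < m + n ∧ (k : ZMod n) = x := by
  have : NeZero n := ⟨hn.ne'⟩
  refine ⟨m + (x - m).val, by omega, ?_, by simp⟩
  have := ZMod.val_lt (x - (m : ZMod n))
  omega

namespace Antiprism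

/-- The vertex `u_k`. -/
def u (n k : ℕ) : Bool × ZMod n := (false, k)

/-- The vertex `v_k`. -/
def v (n k : ℕ) : Bool × ZMod n := (true, k)

/-- The index of the vertex `v_j` that is paired with `u_k`, for `1 ≤ k ≤ n`. -/
def mate (k : ℕ) : ℕ := if k = 1 then 5 else if k ≤ 4 then k else k + 1

/-- The pairing `{u_1 v_5, u_2 v_2, u_3 v_3, u_4 v_4} ∪ {u_i v_{i+1} : 5 ≤ i ≤ n}`. -/
def pairing (n : ℕ) : Set (Sym2 (Bool × ZMod n)) :=
  {e | ∃ k, 1 ≤ k ∧ k ≤ n ∧ e = s(u n k, v n (mate k))}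

theorem pairing_eq {n : ℕ} (hn : 7 ≤ n) :
    pairing n = {s(((false, 1) : Bool × ZMod n), (true, 5)), s((false, 2), (true, 2)),
        s((false, 3), (true, 3)), s((false, 4), (true, 4))} ∪
      {e | ∃ i : ℕ, 5 ≤ i ∧ i ≤ n ∧
        e = s(((false, (i : ZMod n)) : Bool × ZMod n), (true, (i : ZMod n) + 1))} := by
  ext e
  simp only [pairing, Set.mem_union, Set.mem_insert_iff, Set.mem_singleton_iff, Set.mem_ofPred_eq]
  constructor
  · rintro ⟨k, h1, hk, rfl⟩
    by_cases h5 : 5 ≤ k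
    · right
      refine ⟨k, h5, hk, ?_⟩
      have : mate k = k + 1 := by unfold mate; split_ifs <;> omega
      simp [u, v, this]
    · left
      interval_cases k <;> simp [u, v, mate]
  · rintro ((rfl | rfl | rfl | rfl) | ⟨i, h5, hi, rfl⟩)
    · exact ⟨1, by omega, by omega, by simp [u, v, mate]⟩
    · exact ⟨2, by omega, by omega, by simp [u, v, mate]⟩
    · exact ⟨3, by omega, by omega, by simp [u, v, mate]⟩
    · exact ⟨4, by omega, by omega, by simp [u, v, mate]⟩
    · refine ⟨i, by omega, hi, ?_⟩
      have : mate i = i + 1 := by unfold mate; split_ifs <;> omega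
      simp [u, v, this]

theorem mate_bounds {n k : ℕ} (hn : 7 ≤ n) (h1 : 1 ≤ k) (hk : k ≤ n) :
    2 ≤ mate k ∧ mate k ≤ n + 1 := by
  unfold mate; split_ifs <;> omega

theorem u_inj {n k l : ℕ} (hk : 1 ≤ k ∧ k ≤ n) (hl : 1 ≤ l ∧ l ≤ n)
    (h : u n k = u n l) : k = l :=
  ZMod.natCast_inj_of_lt (congrArg Prod.snd h) (by omega) (by omega)

theorem v_mate_inj {n k l : ℕ} (hn : 7 ≤ n) (hk : 1 ≤ k ∧ k ≤ n) (hl : 1 ≤ l ∧ l ≤ n)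
    (h : v n (mate k) = v n (mate l)) : k = l := by
  have bk := mate_bounds hn hk.1 hk.2
  have bl := mate_bounds hn hl.1 hl.2
  have : mate k = mate l :=
    ZMod.natCast_inj_of_lt (congrArg Prod.snd h) (by omega) (by omega)
  unfold mate at this
  split_ifs at this <;> omega

theorem u_ne_v {n k l : ℕ} : u n k ≠ v n l := by simp [u, v]

theorem v_ne_u {n k l : ℕ} : v n k ≠ u n l := by simp [u, v]

theorem exists_eq_u_or_v_mate {n : ℕ} (hn : 7 ≤ n) (x : Bool × ZMod n) :
    ∃ k, (1 ≤ k ∧ k ≤ n) ∧ (x = u n k ∨ x = v n (mate k)) := by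
  obtain ⟨b, x⟩ := x
  cases b
  · obtain ⟨k, h1, hk, rfl⟩ := ZMod.exists_natCast_eq (by omega : 0 < n) 1 x
    exact ⟨k, by omega, Or.inl rfl⟩
  · obtain ⟨j, h2, hj, rfl⟩ := ZMod.exists_natCast_eq (by omega : 0 < n) 2 x
    obtain ⟨k, hk, rfl⟩ : ∃ k, (1 ≤ k ∧ k ≤ n) ∧ mate k = j := by
      refine ⟨if j = 5 then 1 else if j ≤ 4 then j else j - 1, ?_, ?_⟩
      · split_ifs <;> omega
      · unfold mate; split_ifs <;> omega
    exact ⟨k, hk, Or.inr rfl⟩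

theorem mk_mem_pairing {n : ℕ} {x y : Bool × ZMod n} :
    s(x, y) ∈ pairing n ↔ ∃ k, (1 ≤ k ∧ k ≤ n) ∧
      (x = u n k ∧ y = v n (mate k) ∨ x = v n (mate k) ∧ y = u n k) := by
  simp only [pairing, Set.mem_ofPred_eq, Sym2.eq_iff, and_assoc]

/-- The pairing as a subgraph of the complete graph. -/
def pairingSubgraph (n : ℕ) : (⊤ : SimpleGraph (Bool × ZMod n)).Subgraph where
  verts := Set.univ
  Adj x y := s(x, y) ∈ pairing n
  adj_sub := by
    intro x y h
    obtain ⟨k, -, ⟨rfl, rfl⟩ | ⟨rfl, rfl⟩⟩ := mk_mem_pairing.mp h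
    · exact u_ne_v
    · exact v_ne_u
  edge_vert _ := Set.mem_univ _
  symm := by
    constructor
    intro x y h
    rwa [Sym2.eq_swap]

theorem edgeSet_pairingSubgraph (n : ℕ) : (pairingSubgraph n).edgeSet = pairing n := by
  ext e
  induction e with
  | _ x y => rfl

theorem isPerfectMatching_pairingSubgraph {n : ℕ} (hn : 7 ≤ n) :
    (pairingSubgraph n).IsPerfectMatching := by
  rw [Subgraph.isPerfectMatching_iff]
  intro x
  change ∃! y, s(x, y) ∈ pairing n
  obtain ⟨k, hk, rfl | rfl⟩ := exists_eq_u_or_v_mate hn x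
  · refine ⟨v n (mate k), mk_mem_pairing.mpr ⟨k, hk, Or.inl ⟨rfl, rfl⟩⟩, fun y hy => ?_⟩
    obtain ⟨l, hl, ⟨h, rfl⟩ | ⟨h, -⟩⟩ := mk_mem_pairing.mp hy
    · rw [u_inj hk hl h]
    · exact absurd h u_ne_v
  · refine ⟨u n k, mk_mem_pairing.mpr ⟨k, hk, Or.inr ⟨rfl, rfl⟩⟩, fun y hy => ?_⟩
    obtain ⟨l, hl, ⟨h, -⟩ | ⟨h, rfl⟩⟩ := mk_mem_pairing.mp hy
    · exact absurd h v_ne_u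
    · rw [v_mate_inj hn hk hl h]

/-- The union of the pairs with index in `A`. -/
def pairs (n : ℕ) (A : Finset ℕ) : Set (Bool × ZMod n) :=
  {x | ∃ k ∈ A, x = u n k ∨ x = v n (mate k)}

theorem pairs_closed {n : ℕ} (hn : 7 ≤ n) {A : Finset ℕ} (hA : ∀ k ∈ A, 1 ≤ k ∧ k ≤ n)
    {x y : Bool × ZMod n} (h : s(x, y) ∈ pairing n) (hx : x ∈ pairs n A) : y ∈ pairs n A := by
  obtain ⟨l, hl, ⟨rfl, rfl⟩ | ⟨rfl, rfl⟩⟩ := mk_mem_pairing.mp h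
  · obtain ⟨k, hkA, h | h⟩ := hx
    · exact ⟨k, hkA, Or.inr (by rw [u_inj hl (hA k hkA) h])⟩
    · exact absurd h u_ne_v
  · obtain ⟨k, hkA, h | h⟩ := hx
    · exact absurd h v_ne_u
    · exact ⟨k, hkA, Or.inl (by rw [v_mate_inj hn hl (hA k hkA) h])⟩

/-- Let `p k`, `q k`, `x k`, `y k` indicate whether a matching contains `v_k u_k`, `u_k v_{k+1}`,
`u_k u_{k+1}`, `v_k v_{k+1}`. Listing the vertices as `v_1, u_1, v_2, u_2, …`, the numbers of
matching edges across consecutive gaps have opposite parities. Hence both gaps next to the pair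
`v_3 u_3`, or both gaps next to the pair `u_6 v_7`, are crossed an even number of times. Double
crossings are excluded by the last four hypotheses, and a pair with no crossing on either side
would be matched with itself. -/
theorem not_consistent_indicators (p q x y : ℕ → ℕ)
    (hu : ∀ k, p (k + 1) + q (k + 1) + x k + x (k + 1) = 1)
    (hv : ∀ k, q k + p (k + 1) + y k + y (k + 1) = 1)
    (p3 : p 3 = 0) (q6 : q 6 = 0) (d2 : x 2 = 0 ∨ y 2 = 0) (d3 : x 3 = 0 ∨ y 3 = 0)
    (d5 : x 5 = 0 ∨ y 6 = 0) (d6 : x 6 = 0 ∨ y 7 = 0) : False := by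
  have u2 := hu 1
  have u3 := hu 2
  have u4 := hu 3
  have u5 := hu 4
  have u6 := hu 5
  have u7 := hu 6
  have v3 := hv 2
  have v4 := hv 3
  have v5 := hv 4
  have v6 := hv 5
  have v7 := hv 6
  simp only [Nat.reduceAdd] at u2 u3 u4 u5 u6 u7 v3 v4 v5 v6 v7
  have even_or_even : (q 2 + x 2 + y 2) % 2 = 0 ∨ (p 6 + x 5 + y 6) % 2 = 0 := by
    clear d2 d3 d5 d6
    omega
  rcases even_or_even with h | h
  · have h' : (q 3 + x 3 + y 3) % 2 = 0 := by
      clear d2 d3 d5 d6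
      omega
    have hq2 : q 2 + x 2 + y 2 = 0 := by
      clear u4 u5 u6 u7 v4 v5 v6 v7 d3 d5 d6
      omega
    have hq3 : q 3 + x 3 + y 3 = 0 := by
      clear u2 u5 u6 u7 v5 v6 v7 d2 d5 d6
      omega
    omega
  · have h' : (p 7 + x 6 + y 7) % 2 = 0 := by
      clear d2 d3 d5 d6
      omega
    have hp6 : p 6 + x 5 + y 6 = 0 := by
      clear u2 u3 u4 u7 v3 v4 v5 d2 d3 d6
      omega
    have hp7 : p 7 + x 6 + y 7 = 0 := by
      clear u2 u3 u4 u5 v3 v4 v5 d2 d3 d5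
      omega
    omega

section Extension

variable {n : ℕ} {N : (accordion n 1).Subgraph}

theorem not_matched_within_pairs (hn : 7 ≤ n) (hN : N.IsPerfectMatching) {a : Bool × ZMod n}
    {c : (⊤ : SimpleGraph (Bool × ZMod n)).Walk a a} (hc : c.IsHamiltonianCycle)
    (hcN : {e | e ∈ c.edges} = pairing n ∪ N.edgeSet)
    {A : Finset ℕ} (hA : ∀ k ∈ A, 1 ≤ k ∧ k ≤ n) {k l : ℕ} (hk : k ∈ A) (hl : l ∉ A)
    (hl' : 1 ≤ l ∧ l ≤ n) : ¬ ∀ x ∈ pairs n A, ∃ y ∈ pairs n A, N.Adj x y := by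
  intro hclosed
  have hS : ∀ x y, s(x, y) ∈ c.edges → x ∈ pairs n A → y ∈ pairs n A := by
    intro x y hxy hx
    have hxy : s(x, y) ∈ pairing n ∪ N.edgeSet := hcN ▸ hxy
    rcases hxy with hxy | hxy
    · exact pairs_closed hn hA hxy hx
    · obtain ⟨z, hz, hxz⟩ := hclosed x hx
      have hzy : z = y := (Subgraph.isPerfectMatching_iff.mp hN x).unique hxz hxy
      exact hzy ▸ hz
  have hiff := fun x => c.mem_iff_of_mem_support hS (hc.mem_support x)
  have hul : u n l ∈ pairs n A :=
    (hiff _).mpr ((hiff (u n k)).mp ⟨k, hk, Or.inl rfl⟩)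
  obtain ⟨m, hm, h | h⟩ := hul
  · exact hl (u_inj hl' (hA m hm) h ▸ hm)
  · exact u_ne_v h

theorem not_adj_mate (hn : 7 ≤ n) (hN : N.IsPerfectMatching) {a : Bool × ZMod n}
    {c : (⊤ : SimpleGraph (Bool × ZMod n)).Walk a a} (hc : c.IsHamiltonianCycle)
    (hcN : {e | e ∈ c.edges} = pairing n ∪ N.edgeSet)
    {k : ℕ} (hk : 2 ≤ k ∧ k ≤ n) : ¬ N.Adj (u n k) (v n (mate k)) := by
  intro h
  refine not_matched_within_pairs hn hN hc hcN (A := {k}) (k := k) (l := 1) (by simp; omega)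
    (by simp) (by simp; omega) (by omega) ?_
  rintro x ⟨m, hm, hx⟩
  obtain rfl := Finset.mem_singleton.mp hm
  rcases hx with rfl | rfl
  · exact ⟨_, ⟨m, hm, Or.inr rfl⟩, h⟩
  · exact ⟨_, ⟨m, hm, Or.inl rfl⟩, h.symm⟩

theorem not_adj_succ_and_adj_mate_succ (hn : 7 ≤ n) (hN : N.IsPerfectMatching)
    {a : Bool × ZMod n}
    {c : (⊤ : SimpleGraph (Bool × ZMod n)).Walk a a} (hc : c.IsHamiltonianCycle)
    (hcN : {e | e ∈ c.edges} = pairing n ∪ N.edgeSet)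
    {k : ℕ} (hk : 2 ≤ k ∧ k + 1 ≤ n) :
    ¬ (N.Adj (u n k) (u n (k + 1)) ∧ N.Adj (v n (mate k)) (v n (mate (k + 1)))) := by
  rintro ⟨hu, hv⟩
  have h0 : k ∈ ({k, k + 1} : Finset ℕ) := by simp
  have h1 : k + 1 ∈ ({k, k + 1} : Finset ℕ) := by simp
  refine not_matched_within_pairs hn hN hc hcN (A := {k, k + 1}) (k := k) (l := 1)
    (by simp; omega) h0 (by simp; omega) (by omega) ?_
  rintro x ⟨m, hm, hx⟩
  rw [Finset.mem_insert, Finset.mem_singleton] at hm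
  rcases hm with rfl | rfl <;> rcases hx with rfl | rfl
  · exact ⟨_, ⟨_, h1, Or.inl rfl⟩, hu⟩
  · exact ⟨_, ⟨_, h1, Or.inr rfl⟩, hv⟩
  · exact ⟨_, ⟨_, h0, Or.inl rfl⟩, hu.symm⟩
  · exact ⟨_, ⟨_, h0, Or.inr rfl⟩, hv.symm⟩

open Classical in
/-- The indicator of adjacency in `N`. -/
noncomputable def ind (N : (accordion n 1).Subgraph) (x y : Bool × ZMod n) : ℕ :=
  if N.Adj x y then 1 else 0

theorem ind_comm (x y : Bool × ZMod n) : ind N x y = ind N y x := by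
  classical exact if_congr (N.adj_comm x y) rfl rfl

theorem adj_of_ind_ne_zero {x y : Bool × ZMod n} (h : ind N x y ≠ 0) : N.Adj x y := by
  by_contra hxy
  simp [ind, hxy] at h

theorem ind_sum_eq_one (hN : N.IsPerfectMatching) {x y₁ y₂ y₃ y₄ : Bool × ZMod n}
    (hx : ∀ y, (accordion n 1).Adj x y → y = y₁ ∨ y = y₂ ∨ y = y₃ ∨ y = y₄)
    (h₁₂ : y₁ ≠ y₂) (h₁₃ : y₁ ≠ y₃) (h₁₄ : y₁ ≠ y₄) (h₂₃ : y₂ ≠ y₃) (h₂₄ : y₂ ≠ y₄)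
    (h₃₄ : y₃ ≠ y₄) : ind N x y₁ + ind N x y₂ + ind N x y₃ + ind N x y₄ = 1 := by
  obtain ⟨y, hy, hu⟩ := Subgraph.isPerfectMatching_iff.mp hN x
  have key : ∀ z, N.Adj x z ↔ z = y := fun z => ⟨hu z, fun h => h ▸ hy⟩
  unfold ind
  rcases hx y (N.adj_sub hy) with rfl | rfl | rfl | rfl <;>
    simp [*, Ne.symm]

theorem natCast_ne_of_lt {a b : ℕ} (hab : a < b) (hba : b < a + n) : (a : ZMod n) ≠ b :=
  fun h => hab.ne (ZMod.natCast_inj_of_lt h (by omega) hba)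

theorem ind_sum_u (hn : 7 ≤ n) (hN : N.IsPerfectMatching) (k : ℕ) :
    ind N (v n (k + 1)) (u n (k + 1)) + ind N (u n (k + 1)) (v n (k + 2)) +
      ind N (u n k) (u n (k + 1)) + ind N (u n (k + 1)) (u n (k + 2)) = 1 := by
  rw [ind_comm (v n (k + 1)), ind_comm (u n k)]
  refine ind_sum_eq_one hN ?_ ?_ u_ne_v.symm u_ne_v.symm u_ne_v.symm u_ne_v.symm ?_
  · rintro ⟨b, y⟩ h
    simp only [accordion, fromRel_adj, u] at h
    cases b <;> simp [u, v] at h ⊢ <;> grind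
  · exact fun h => natCast_ne_of_lt (n := n) (by omega) (by omega) (congrArg Prod.snd h)
  · exact fun h => natCast_ne_of_lt (n := n) (by omega) (by omega) (congrArg Prod.snd h)

theorem ind_sum_v (hn : 7 ≤ n) (hN : N.IsPerfectMatching) (k : ℕ) :
    ind N (u n k) (v n (k + 1)) + ind N (v n (k + 1)) (u n (k + 1)) +
      ind N (v n k) (v n (k + 1)) + ind N (v n (k + 1)) (v n (k + 2)) = 1 := by
  rw [ind_comm (u n k), ind_comm (v n k)]
  refine ind_sum_eq_one hN ?_ ?_ u_ne_v u_ne_v u_ne_v u_ne_v ?_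
  · rintro ⟨b, y⟩ h
    simp only [accordion, fromRel_adj, v] at h
    cases b <;> simp [u, v] at h ⊢ <;> grind
  · exact fun h => natCast_ne_of_lt (n := n) (by omega) (by omega) (congrArg Prod.snd h)
  · exact fun h => natCast_ne_of_lt (n := n) (by omega) (by omega) (congrArg Prod.snd h)

theorem not_hamiltonian (hn : 7 ≤ n) (hN : N.IsPerfectMatching) {a : Bool × ZMod n}
    {c : (⊤ : SimpleGraph (Bool × ZMod n)).Walk a a} (hc : c.IsHamiltonianCycle)
    (hcN : {e | e ∈ c.edges} = pairing n ∪ N.edgeSet) : False := by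
  have single : ∀ k, 2 ≤ k ∧ k ≤ n → ind N (u n k) (v n (mate k)) = 0 := fun k hk => by
    by_contra h
    exact not_adj_mate hn hN hc hcN hk (adj_of_ind_ne_zero h)
  have double : ∀ k, 2 ≤ k ∧ k + 1 ≤ n →
      ind N (u n k) (u n (k + 1)) = 0 ∨ ind N (v n (mate k)) (v n (mate (k + 1))) = 0 :=
    fun k hk => by
      by_contra! h
      exact not_adj_succ_and_adj_mate_succ hn hN hc hcN hk
        ⟨adj_of_ind_ne_zero h.1, adj_of_ind_ne_zero h.2⟩
  exact not_consistent_indicators (fun k => ind N (v n k) (u n k))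
    (fun k => ind N (u n k) (v n (k + 1))) (fun k => ind N (u n k) (u n (k + 1)))
    (fun k => ind N (v n k) (v n (k + 1))) (ind_sum_u hn hN) (ind_sum_v hn hN)
    ((ind_comm _ _).trans (single 3 (by omega))) (single 6 (by omega))
    (double 2 (by omega)) (double 3 (by omega)) (double 5 (by omega)) (double 6 (by omega))

end Extension

end Antiprism

/-- For every `n ≥ 7`, the pairing
`M = {u_1 v_5, u_2 v_2, u_3 v_3, u_4 v_4} ∪ {u_i v_{i+1} : 5 ≤ i ≤ n}` of the antiprism
`A_n = A[n,1]` cannot be extended to a Hamiltonian cycle of `K_{A_n}`; in particular,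
`A[n,1]` does not have the PH-property for `n ≥ 7`. -/
theorem antiprism_pairing_not_extendable (n : ℕ) (hn : 7 ≤ n)
    (M : Set (Sym2 (Bool × ZMod n)))
    (hM : M = {s(((false, 1) : Bool × ZMod n), (true, 5)), s((false, 2), (true, 2)),
        s((false, 3), (true, 3)), s((false, 4), (true, 4))} ∪
      {e | ∃ i : ℕ, 5 ≤ i ∧ i ≤ n ∧
        e = s(((false, (i : ZMod n)) : Bool × ZMod n), (true, (i : ZMod n) + 1))}) :
    (∃ P : (⊤ : SimpleGraph (Bool × ZMod n)).Subgraph,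
        P.IsPerfectMatching ∧ P.edgeSet = M) ∧
    (¬ ∃ N : (accordion n 1).Subgraph, N.IsPerfectMatching ∧
        ∃ (v : Bool × ZMod n) (c : (⊤ : SimpleGraph (Bool × ZMod n)).Walk v v),
          c.IsHamiltonianCycle ∧ {e | e ∈ c.edges} = M ∪ N.edgeSet) ∧
    ¬ IsPH (accordion n 1) := by
  have hM' : M = Antiprism.pairing n := hM.trans (Antiprism.pairing_eq hn).symm
  subst hM'
  have hP := Antiprism.isPerfectMatching_pairingSubgraph hn
  refine ⟨⟨_, hP, Antiprism.edgeSet_pairingSubgraph n⟩, ?_, fun hPH => ?_⟩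
  · rintro ⟨N, hN, a, c, hc, hcN⟩
    exact Antiprism.not_hamiltonian hn hN hc hcN
  · obtain ⟨N, hN, a, c, hc, hcN⟩ := hPH _ hP
    rw [Antiprism.edgeSet_pairingSubgraph] at hcN
    exact Antiprism.not_hamiltonian hn hN hc hcN
end

section
/- For every integer n ≥ 3, the accordion graph A[n,2] has the PH-property: for every pairing M of A[n,2] there exists a perfect matching N of A[n,2] such that M ∪ N is the edge set of a Hamiltonian cycle of the complete graph on the vertices of A[n,2]. -/
open SimpleGraph

open Function

/-- The graph joining every vertex `v` to its images `f v` and `g v`. -/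
def involutionGraph {V : Type*} (f g : V → V) : SimpleGraph V :=
  SimpleGraph.fromRel (fun a b => f a = b ∨ g a = b)

namespace involutionGraph

variable {V : Type*} {f g : V → V}

lemma adj_iff (hf : Involutive f) (hg : Involutive g) {a b : V} :
    (involutionGraph f g).Adj a b ↔ a ≠ b ∧ (f a = b ∨ g a = b) := by
  have h₁ : f b = a ↔ f a = b := by rw [hf.eq_iff, eq_comm]
  have h₂ : g b = a ↔ g a = b := by rw [hg.eq_iff, eq_comm]
  rw [involutionGraph, SimpleGraph.fromRel_adj, h₁, h₂, or_self]

lemma reachable_left (v : V) : (involutionGraph f g).Reachable v (f v) := by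
  by_cases h : v = f v
  · rw [← h]
  · exact SimpleGraph.Adj.reachable ((SimpleGraph.fromRel_adj _ _ _).2 ⟨h, .inl (.inl rfl)⟩)

lemma reachable_right (v : V) : (involutionGraph f g).Reachable v (g v) := by
  by_cases h : v = g v
  · rw [← h]
  · exact SimpleGraph.Adj.reachable ((SimpleGraph.fromRel_adj _ _ _).2 ⟨h, .inl (.inr rfl)⟩)

lemma reachable_induction (hf : Involutive f) (hg : Involutive g) {P : V → Prop}
    (hPf : ∀ v, P v → P (f v)) (hPg : ∀ v, P v → P (g v)) {a b : V}
    (h : (involutionGraph f g).Reachable a b) (ha : P a) : P b := by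
  obtain ⟨p⟩ := h
  induction p with
  | nil => exact ha
  | cons hadj _ ih =>
    obtain ⟨-, rfl | rfl⟩ := (adj_iff hf hg).1 hadj
    · exact ih (hPf _ ha)
    · exact ih (hPg _ ha)

end involutionGraph

lemma Finset.even_card_of_involutive {V : Type*} {f : V → V} (hf : Involutive f)
    (hne : ∀ v, f v ≠ v) (s : Finset V) (hs : ∀ v ∈ s, f v ∈ s) : Even s.card := by
  have h : ∑ _v ∈ s, (1 : ZMod 2) = 0 :=
    Finset.sum_involution (fun v _ => f v) (fun _ _ => by decide) (fun v _ _ => hne v)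
      (fun v hv => hs v hv) (fun v _ => hf v)
  rw [Finset.sum_const, nsmul_one] at h
  exact (ZMod.natCast_eq_zero_iff_even).1 h

section Switch

variable {V : Type*} [DecidableEq V]

/-- The conjugate of `g` by the transposition of `x` and `y`. -/
def conjSwap (g : V → V) (x y v : V) : V :=
  Equiv.swap x y (g (Equiv.swap x y v))

lemma conjSwap_involutive {g : V → V} (hg : Involutive g) (x y : V) :
    Involutive (conjSwap g x y) := fun v => by
  simp [conjSwap, hg (Equiv.swap x y v)]

lemma conjSwap_comm (g : V → V) (x y : V) : conjSwap g x y = conjSwap g y x := by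
  funext v
  simp only [conjSwap, Equiv.swap_comm]

variable {f g : V → V}

/-- The edge of `g` at `x` lies on a cycle, which survives conjugation at a vertex `y`
of another component up to that edge. -/
lemma reachable_conjSwap_edge [Finite V] (hf : Involutive f) (hf' : ∀ v, f v ≠ v)
    (hg : Involutive g) (hg' : ∀ v, g v ≠ v) {x y : V}
    (hxy : ¬ (involutionGraph f g).Reachable x y) :
    (involutionGraph f (conjSwap g x y)).Reachable x (g x) := by
  classical
  have := Fintype.ofFinite V
  by_contra hcon
  have hcinv := conjSwap_involutive hg x y
  set H := involutionGraph f g with hH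
  set H' := involutionGraph f (conjSwap g x y) with hH'
  let s : Finset V := {v | H.Reachable x v ∧ H'.Reachable x v}
  have hfs : ∀ v ∈ s, f v ∈ s := fun v hv => by
    simp only [s, Finset.mem_filter, Finset.mem_univ, true_and] at hv ⊢
    exact ⟨hv.1.trans (involutionGraph.reachable_left v),
      hv.2.trans (involutionGraph.reachable_left v)⟩
  have hxs : x ∈ s := by simp [s]
  have hgs : ∀ v ∈ s.erase x, g v ∈ s.erase x := fun v hv => by
    simp only [s, Finset.mem_erase, Finset.mem_filter, Finset.mem_univ, true_and] at hv ⊢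
    obtain ⟨hvx, hv₁, hv₂⟩ := hv
    have hgv : H.Reachable x (g v) := hv₁.trans (involutionGraph.reachable_right v)
    have hgx : g v ≠ x := by
      rintro rfl
      rw [hg v] at hcon
      exact hcon hv₂
    have hvy : v ≠ y := by rintro rfl; exact hxy hv₁
    have hgy : g v ≠ y := by rintro rfl; exact hxy hgv
    refine ⟨hgx, hgv, ?_⟩
    have := hv₂.trans (involutionGraph.reachable_right (f := f) (g := conjSwap g x y) v)
    rwa [conjSwap, Equiv.swap_apply_of_ne_of_ne hvx hvy,
      Equiv.swap_apply_of_ne_of_ne hgx hgy] at this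
  have h₁ := Finset.even_card_of_involutive hf hf' s hfs
  have h₂ := Finset.even_card_of_involutive hg hg' _ hgs
  rw [← Finset.card_erase_add_one hxs] at h₁
  exact (Nat.not_even_iff_odd.2 h₂.add_one) h₁

lemma conjSwap_apply_left (hg' : ∀ v, g v ≠ v) {x y : V} (h : g y ≠ x) :
    conjSwap g x y x = g y := by
  rw [conjSwap, Equiv.swap_apply_left, Equiv.swap_apply_of_ne_of_ne h (hg' y)]

/-- Conjugating `g` by the transposition of two vertices in different components
merges these components. -/
lemma reachable_conjSwap [Finite V] (hf : Involutive f) (hf' : ∀ v, f v ≠ v)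
    (hg : Involutive g) (hg' : ∀ v, g v ≠ v) {x y : V}
    (hxy : ¬ (involutionGraph f g).Reachable x y) :
    (involutionGraph f (conjSwap g x y)).Reachable x y ∧
      ∀ a b, (involutionGraph f g).Reachable a b →
        (involutionGraph f (conjSwap g x y)).Reachable a b := by
  have hyx : ¬ (involutionGraph f g).Reachable y x := fun h => hxy h.symm
  have hx := reachable_conjSwap_edge hf hf' hg hg' hxy
  have hy := reachable_conjSwap_edge hf hf' hg hg' hyx
  rw [conjSwap_comm] at hy
  have hgy : g y ≠ x := fun h => hyx (h ▸ involutionGraph.reachable_right y)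
  have hxgy := involutionGraph.reachable_right (f := f) (g := conjSwap g x y) x
  rw [conjSwap_apply_left hg' hgy] at hxgy
  refine ⟨hxgy.trans hy.symm, fun a b hab => ?_⟩
  refine involutionGraph.reachable_induction hf hg
    (fun v hv => hv.trans (involutionGraph.reachable_left v))
    (fun v hv => hv.trans ?_) hab (.refl a)
  by_cases hvx : v = x
  · exact hvx ▸ hx
  by_cases hvy : v = y
  · exact hvy ▸ hy
  by_cases hgvx : g v = x
  · rw [← hgvx, hg v] at hx
    exact hgvx ▸ hx.symm
  by_cases hgvy : g v = y
  · rw [← hgvy, hg v] at hy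
    exact hgvy ▸ hy.symm
  have := involutionGraph.reachable_right (f := f) (g := conjSwap g x y) v
  rwa [conjSwap, Equiv.swap_apply_of_ne_of_ne hvx hvy,
    Equiv.swap_apply_of_ne_of_ne hgvx hgvy] at this

end Switch

/-- If fixed-point-free involutions `f` and `g` generate a connected graph on more than two
vertices, then its edges form a Hamiltonian cycle. -/
lemma exists_isHamiltonianCycle_of_connected {V : Type*} [DecidableEq V] [Finite V]
    {f g : V → V} (hf : Involutive f) (hf' : ∀ v, f v ≠ v) (hg : Involutive g)
    (hg' : ∀ v, g v ≠ v) (hcard : 2 < Nat.card V)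
    (hconn : ∀ a b, (involutionGraph f g).Reachable a b) (v : V) :
    ∃ c : (⊤ : SimpleGraph V).Walk v v, c.IsHamiltonianCycle ∧
      ∀ a b, s(a, b) ∈ c.edges ↔ f a = b ∨ g a = b := by
  set H := involutionGraph f g with hH
  have hadj : ∀ a b, H.Adj a b ↔ f a = b ∨ g a = b := fun a b => by
    rw [hH, involutionGraph.adj_iff hf hg, and_iff_right_iff_imp]
    rintro (rfl | rfl)
    · exact (hf' a).symm
    · exact (hg' a).symm
  have hfg : ∀ a, f a ≠ g a := fun a ha => by
    have huniv : (Set.univ : Set V) ⊆ {a, f a} := fun b _ => by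
      refine involutionGraph.reachable_induction hf hg (P := fun b => b ∈ ({a, f a} : Set V))
        ?_ ?_ (hconn a b) (by simp)
      · rintro v (rfl | rfl)
        · simp
        · simp [hf a]
      · rintro v (rfl | rfl)
        · simp [ha]
        · rw [ha, hg a]; simp
    have := Set.ncard_le_ncard huniv
    rw [Set.ncard_univ] at this
    exact absurd (this.trans (Set.ncard_insert_le _ _)) (by simpa using hcard)
  have hnbr : ∀ a, H.neighborSet a = {f a, g a} := fun a => by
    ext b
    simp [hadj, eq_comm]
  have hcyc : H.IsCycles := fun a _ => by
    rw [hnbr, Set.ncard_pair (hfg a)]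
  obtain ⟨p, hp, hverts⟩ := hcyc.exists_cycle_toSubgraph_verts_eq_connectedComponentSupp
    (v := v) (c := H.connectedComponentMk v) rfl ⟨f v, by simp [hadj]⟩
  have hmem : ∀ w, w ∈ p.toSubgraph.verts := fun w => by
    rw [hverts, ConnectedComponent.mem_supp_iff, ConnectedComponent.eq]
    exact hconn w v
  refine ⟨p.mapLe le_top, ⟨hp.mapLe le_top, ?_⟩, fun a b => ?_⟩
  · refine ((hp.mapLe le_top).isPath_tail.isHamiltonian_iff).2 fun w => ?_
    have hw : w ∈ (p.mapLe (le_top : H ≤ ⊤)).support := by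
      simpa using hmem w
    rw [← Walk.cons_support_tail (hp.mapLe le_top).not_nil, List.mem_cons] at hw
    obtain rfl | hw := hw
    · exact Walk.end_mem_support _
    · exact hw
  · classical
    have := Fintype.ofFinite V
    rw [← hadj, ← hp.adj_toSubgraph_iff_of_isCycles hcyc (hmem a),
      ← Walk.adj_toSubgraph_mapLe le_top, Walk.adj_toSubgraph_iff_mem_edges]

/-- The position of a vertex of `A[n,2]`: `u_i` and `v_{i+1}` have the same neighbours and
lie in layer `i`. -/
def layer {n : ℕ} (v : Bool × ZMod n) : ZMod n :=
  if v.1 then v.2 - 1 else v.2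

/-- The other vertex in the same layer. -/
def twin {n : ℕ} (v : Bool × ZMod n) : Bool × ZMod n :=
  (!v.1, if v.1 then v.2 - 1 else v.2 + 1)

section Layers

variable {n : ℕ}

@[simp] lemma twin_twin (v : Bool × ZMod n) : twin (twin v) = v := by
  obtain ⟨_ | _, i⟩ := v <;> simp [twin]

@[simp] lemma layer_twin (v : Bool × ZMod n) : layer (twin v) = layer v := by
  obtain ⟨_ | _, i⟩ := v <;> simp [twin, layer]

lemma layer_eq_iff {v w : Bool × ZMod n} : layer v = layer w ↔ w = v ∨ w = twin v := by
  obtain ⟨_ | _, i⟩ := v <;> obtain ⟨_ | _, j⟩ := w <;>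
    simp [twin, layer, eq_comm, eq_sub_iff_add_eq]

lemma accordion_adj_of_layer (hn : 3 ≤ n) {v w : Bool × ZMod n} (h : layer w = layer v + 1) :
    (accordion n 2).Adj v w := by
  have : Fact (1 < n) := ⟨by omega⟩
  have hne : v ≠ w := by
    rintro rfl
    simp at h
  rw [accordion, SimpleGraph.fromRel_adj]
  refine ⟨hne, ?_⟩
  obtain ⟨_ | _, i⟩ := v <;> obtain ⟨_ | _, j⟩ := w <;>
    simp only [layer, Bool.false_eq_true, if_false, if_true] at h
  · simp [h]
  · have : j = i + 2 := by linear_combination h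
    simp [this]
  · have : j = i := by linear_combination h
    simp [this]
  · have : j = i + 1 := by linear_combination h
    simp [this]

/-- `g` sends one vertex of every layer to the next layer and the other one to the
previous layer. -/
def IsZigzag (g : Bool × ZMod n → Bool × ZMod n) : Prop :=
  ∀ v, (layer (g v) = layer v + 1 ∧ layer (g (twin v)) = layer v - 1) ∨
    (layer (g v) = layer v - 1 ∧ layer (g (twin v)) = layer v + 1)

lemma IsZigzag.adj (hn : 3 ≤ n) {g : Bool × ZMod n → Bool × ZMod n} (hg : IsZigzag g)
    (v : Bool × ZMod n) : (accordion n 2).Adj v (g v) := by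
  obtain ⟨h, -⟩ | ⟨h, -⟩ := hg v
  · exact accordion_adj_of_layer hn h
  · exact (accordion_adj_of_layer hn (by rw [h, sub_add_cancel])).symm

lemma layer_swap_twin (x v : Bool × ZMod n) : layer (Equiv.swap x (twin x) v) = layer v := by
  rw [Equiv.swap_apply_def]
  split_ifs with h₁ h₂
  · simp [h₁]
  · simp [h₂]
  · rfl

lemma swap_twin_twin (x v : Bool × ZMod n) :
    Equiv.swap x (twin x) (twin v) = twin (Equiv.swap x (twin x) v) := by
  by_cases h₁ : v = x
  · simp [h₁]
  by_cases h₂ : v = twin x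
  · simp [h₂]
  have h₃ : twin v ≠ x := fun h => h₂ (by rw [← h, twin_twin])
  have h₄ : twin v ≠ twin x := fun h => h₁ (by rw [← twin_twin v, h, twin_twin])
  rw [Equiv.swap_apply_of_ne_of_ne h₁ h₂, Equiv.swap_apply_of_ne_of_ne h₃ h₄]

lemma IsZigzag.conjSwap {g : Bool × ZMod n → Bool × ZMod n} (hg : IsZigzag g)
    (x : Bool × ZMod n) : IsZigzag (conjSwap g x (twin x)) := fun v => by
  have h := hg (Equiv.swap x (twin x) v)
  simpa only [_root_.conjSwap, layer_swap_twin, swap_twin_twin] using h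

lemma exists_isZigzag (n : ℕ) :
    ∃ g : Bool × ZMod n → Bool × ZMod n, Involutive g ∧ IsZigzag g := by
  refine ⟨fun v => (!v.1, if v.1 then v.2 - 2 else v.2 + 2), ?_, ?_⟩
  · rintro ⟨_ | _, i⟩ <;> simp
  · rintro ⟨_ | _, i⟩
    · left
      simp only [layer, twin]
      constructor <;> simp <;> ring
    · right
      simp only [layer, twin]
      constructor <;> simp <;> ring

/-- If twins are joined, the whole graph is connected. -/
lemma IsZigzag.reachable [NeZero n] {f g : Bool × ZMod n → Bool × ZMod n} (hg : IsZigzag g)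
    (h : ∀ v, (involutionGraph f g).Reachable v (twin v)) (a b : Bool × ZMod n) :
    (involutionGraph f g).Reachable a b := by
  have hlayer : ∀ k : ℕ, ∃ w, layer w = layer a + (k : ZMod n) ∧ (involutionGraph f g).Reachable a w := by
    intro k
    induction k with
    | zero => exact ⟨a, by simp, .refl a⟩
    | succ k ih =>
      obtain ⟨w, hw, haw⟩ := ih
      obtain ⟨h₁, -⟩ | ⟨-, h₁⟩ := hg w
      · exact ⟨g w, by rw [h₁, hw]; push_cast; ring,
          haw.trans (involutionGraph.reachable_right w)⟩
      · exact ⟨g (twin w), by rw [h₁, hw]; push_cast; ring,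
          (haw.trans (h w)).trans (involutionGraph.reachable_right _)⟩
  obtain ⟨w, hw, haw⟩ := hlayer (layer b - layer a).val
  rw [ZMod.natCast_zmod_val, add_sub_cancel, layer_eq_iff] at hw
  obtain rfl | rfl := hw
  · exact haw
  · exact haw.trans (h w)

/-- For every fixed-point-free involution `f`, some zigzag matching connects everything. -/
lemma exists_isZigzag_reachable (hn : 3 ≤ n) {f : Bool × ZMod n → Bool × ZMod n}
    (hf : Involutive f) (hf' : ∀ v, f v ≠ v) :
    ∃ g : Bool × ZMod n → Bool × ZMod n, Involutive g ∧ IsZigzag g ∧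
      ∀ a b, (involutionGraph f g).Reachable a b := by
  have : NeZero n := ⟨by omega⟩
  let S : (Bool × ZMod n → Bool × ZMod n) → Set ((Bool × ZMod n) × (Bool × ZMod n)) :=
    fun g => {p | (involutionGraph f g).Reachable p.1 p.2}
  obtain ⟨g, ⟨hg, hz⟩, hmax⟩ := Set.exists_max_image
    {g : Bool × ZMod n → Bool × ZMod n | Involutive g ∧ IsZigzag g}
    (fun g => (S g).ncard) (Set.toFinite _) (exists_isZigzag n)
  refine ⟨g, hg, hz, hz.reachable fun x => ?_⟩
  by_contra hx
  obtain ⟨h₁, h₂⟩ := reachable_conjSwap hf hf' hg (fun v => (hz.adj hn v).ne') hx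
  refine (hmax _ ⟨conjSwap_involutive hg x (twin x), hz.conjSwap x⟩).not_gt
    (Set.ncard_lt_ncard ⟨fun p hp => h₂ _ _ hp, fun hsub => hx ?_⟩)
  exact hsub (show (x, twin x) ∈ S _ from h₁)

end Layers

/-- For every `n ≥ 3`, the accordion graph `A[n,2]` has the PH-property. -/
theorem accordion_two_isPH (n : ℕ) (hn : 3 ≤ n) : IsPH (accordion n 2) := by
  intro M hM
  have : NeZero n := ⟨by omega⟩
  choose f hf huniq using fun v => hM.1 (hM.2 v)
  have hfadj : ∀ a b, M.Adj a b ↔ f a = b := fun a b =>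
    ⟨fun h => (huniq a b h).symm, fun h => h ▸ hf a⟩
  have hfinv : Involutive f := fun v => (hfadj _ _).1 (hf v).symm
  have hf' : ∀ v, f v ≠ v := fun v => (hf v).ne.symm
  obtain ⟨g, hg, hz, hconn⟩ := exists_isZigzag_reachable hn hfinv hf'
  let N : (accordion n 2).Subgraph :=
    { verts := Set.univ
      Adj := fun a b => g a = b
      adj_sub := fun {a b} h => h ▸ hz.adj hn a
      edge_vert := fun _ => Set.mem_univ _
      symm := ⟨fun a b h => by rw [← h, hg a]⟩ }
  have hN : N.IsPerfectMatching :=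
    ⟨fun a _ => ⟨g a, rfl, fun b hb => Eq.symm hb⟩, fun v => Set.mem_univ v⟩
  have hcard : 2 < Nat.card (Bool × ZMod n) := by
    rw [Nat.card_prod, Nat.card_zmod, Nat.card_eq_fintype_card, Fintype.card_bool]
    omega
  obtain ⟨c, hc, hedges⟩ := exists_isHamiltonianCycle_of_connected hfinv hf' hg
    (fun v => (hz.adj hn v).ne') hcard hconn (false, 0)
  refine ⟨N, hN, (false, 0), c, hc, ?_⟩
  ext e
  induction e with
  | h a b =>
    rw [Set.mem_ofPred_eq, hedges, Set.mem_union, Subgraph.mem_edgeSet, Subgraph.mem_edgeSet,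
      hfadj]
end

section
/- Let n and k be integers with n ≥ 3 and 0 < k ≤ n/2. If gcd(n,k) ≥ 6, then the accordion graph A[n,k] does not have the PMH-property: there exists a perfect matching M of A[n,k] such that no perfect matching N of A[n,k] makes M ∪ N the edge set of a Hamiltonian cycle of A[n,k]. -/
open SimpleGraph

/-- An integer weight on the edges of an accordion graph on `ZMod n`: `x i`, `y i`, `u i`, `v i`
are the weights of `u_i v_i`, `u_i v_{i+k}`, `u_i u_{i+1}`, `v_i v_{i+1}`. -/
structure AccordionWeight (n : ℕ) where
  x : ZMod n → ℤ
  y : ZMod n → ℤ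
  u : ZMod n → ℤ
  v : ZMod n → ℤ

namespace AccordionWeight

variable {n : ℕ}

/-- The weight is nonnegative and the weights at each vertex sum to `1`. -/
structure IsPerfect (k : ℕ) (P : AccordionWeight n) : Prop where
  x_nonneg : ∀ i, 0 ≤ P.x i
  y_nonneg : ∀ i, 0 ≤ P.y i
  u_nonneg : ∀ i, 0 ≤ P.u i
  v_nonneg : ∀ i, 0 ≤ P.v i
  sum_u : ∀ i, P.x i + P.y i + P.u i + P.u (i - 1) = 1
  sum_v : ∀ i, P.x i + P.y (i - k) + P.v i + P.v (i - 1) = 1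

/-- No edge carries weight of both `P` and `Q`. -/
structure Disjoint (P Q : AccordionWeight n) : Prop where
  x : ∀ i, P.x i + Q.x i ≤ 1
  y : ∀ i, P.y i + Q.y i ≤ 1
  u : ∀ i, P.u i + Q.u i ≤ 1
  v : ∀ i, P.v i + Q.v i ≤ 1

/-- A nonempty set of vertices closed under the edges in the support of `P` and `Q` is
everything. -/
def Spanning (k : ℕ) (P Q : AccordionWeight n) : Prop :=
  ∀ S : Bool × ZMod n → Prop, (∃ a, S a) →
    (∀ i, P.x i + Q.x i = 1 → (S (false, i) ↔ S (true, i))) →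
    (∀ i, P.y i + Q.y i = 1 → (S (false, i) ↔ S (true, i + k))) →
    (∀ i, P.u i + Q.u i = 1 → (S (false, i) ↔ S (false, i + 1))) →
    (∀ i, P.v i + Q.v i = 1 → (S (true, i) ↔ S (true, i + 1))) → ∀ a, S a

/-- Height of the face below row `r` in the column of faces between `u_s` and `v_{s+k}`. -/
def heightA (P Q : AccordionWeight n) (s : ZMod n) (r : ℕ) : ℤ :=
  1 + ∑ j ∈ Finset.range r, (-1) ^ j * (P.y (s + j) - Q.y (s + j))

/-- Height of the face below row `r` in the column of faces between `v_s` and `u_s`. -/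
def heightB (P Q : AccordionWeight n) (s : ZMod n) (r : ℕ) : ℤ :=
  ∑ j ∈ Finset.range r, -((-1) ^ j * (P.x (s + j) - Q.x (s + j)))

/-- The height functions in adjacent columns differ by the flow along the edges separating them. -/
theorem heightB_sub_heightA {k : ℕ} {P Q : AccordionWeight n} (hP : P.IsPerfect k)
    (hQ : Q.IsPerfect k) {s : ZMod n} (hs : P.u (s - 1) = 1) (hs' : Q.u (s - 1) = 0) (r : ℕ) :
    heightB P Q s r - heightA P Q s r = -((-1) ^ r * (P.u (s + r - 1) - Q.u (s + r - 1))) := by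
  induction r with
  | zero => simp [heightA, heightB, hs, hs']
  | succ r ih =>
    have h1 := hP.sum_u (s + r)
    have h2 := hQ.sum_u (s + r)
    have e : s + ((r + 1 : ℕ) : ZMod n) - 1 = s + r := by push_cast; ring
    rw [e]
    simp only [heightA, heightB, Finset.sum_range_succ] at ih ⊢
    rw [pow_succ]
    linear_combination ih + (-1) ^ r * (h2 - h1)

theorem heightA_sub_heightB {k : ℕ} {P Q : AccordionWeight n} (hP : P.IsPerfect k)
    (hQ : Q.IsPerfect k) {s : ZMod n} (hs : P.v (s - 1) = 1) (hs' : Q.v (s - 1) = 0) (r : ℕ) :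
    heightA P Q (s - k) r - heightB P Q s r =
      (-1) ^ r * (P.v (s + r - 1) - Q.v (s + r - 1)) := by
  induction r with
  | zero => simp [heightA, heightB, hs, hs']
  | succ r ih =>
    have h1 := hP.sum_v (s + r)
    have h2 := hQ.sum_v (s + r)
    have e : s + ((r + 1 : ℕ) : ZMod n) - 1 = s + r := by push_cast; ring
    have e' : s - (k : ZMod n) + r = s + r - k := by ring
    rw [e]
    simp only [heightA, heightB, Finset.sum_range_succ, e'] at ih ⊢
    rw [pow_succ]
    linear_combination ih + (-1) ^ r * (h1 - h2)

/-- The level of a vertex: the least height of a face around it. -/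
def level (P Q : AccordionWeight n) (k d : ℕ) (ρ : ZMod n → ZMod d) :
    Bool × ZMod n → ℤ
  | (false, i) =>
    let r := (ρ i).val
    min (min (heightB P Q (i - r) r) (heightA P Q (i - r) r))
      (min (heightB P Q (i - r) (r + 1)) (heightA P Q (i - r) (r + 1)))
  | (true, i) =>
    let r := (ρ i).val
    min (min (heightA P Q (i - r - k) r) (heightB P Q (i - r) r))
      (min (heightA P Q (i - r - k) (r + 1)) (heightB P Q (i - r) (r + 1)))

/-- Around a vertex whose four edges carry two unit weights, the four surrounding heights take
only two values, so both edges in the support see the same minimum. -/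
theorem min_heights {p q p' q' e m₁ m₂ m₃ m₄ n₁ n₂ n₃ n₄ : ℤ} (he : e = 1 ∨ e = -1)
    (hm₁ : 0 ≤ m₁) (hm₂ : 0 ≤ m₂) (hm₃ : 0 ≤ m₃) (hm₄ : 0 ≤ m₄)
    (hn₁ : 0 ≤ n₁) (hn₂ : 0 ≤ n₂) (hn₃ : 0 ≤ n₃) (hn₄ : 0 ≤ n₄)
    (hm : m₁ + m₂ + m₃ + m₄ = 1) (hn : n₁ + n₂ + n₃ + n₄ = 1)
    (h₁ : p' = p - e * (m₁ - n₁)) (h₂ : q' = q + e * (m₂ - n₂))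
    (h₃ : p' - q' = e * (m₃ - n₃)) (h₄ : p - q = -(e * (m₄ - n₄))) :
    (m₁ + n₁ = 1 → min (min p q) (min p' q') = min p p') ∧
    (m₂ + n₂ = 1 → min (min p q) (min p' q') = min q q') ∧
    (m₃ + n₃ = 1 → min (min p q) (min p' q') = min p' q') ∧
    (m₄ + n₄ = 1 → min (min p q) (min p' q') = min p q) := by
  rcases he with rfl | rfl <;> refine ⟨?_, ?_, ?_, ?_⟩ <;> intro h <;> omega

theorem exists_eq_one_of_steps {f : ℕ → ℤ} {d : ℕ} (h0 : f 0 ≤ 1) (hd : 2 ≤ f d)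
    (hstep : ∀ j, f (j + 1) ≤ f j + 1) : ∃ j < d, f j = 1 ∧ f (j + 1) = 2 := by
  induction d with
  | zero => omega
  | succ d ih =>
    by_cases h : 2 ≤ f d
    · obtain ⟨j, hj, h'⟩ := ih h
      exact ⟨j, by omega, h'⟩
    · have := hstep d
      exact ⟨d, by omega, by omega, by omega⟩


section Core

variable {k d : ℕ} {ρ : ZMod n →+* ZMod d} {P Q : AccordionWeight n}

/-- The perfect matching used for the obstruction, with rows given by `ρ`: all edges between row
`-1` and row `0`, and in every other row the edges `u_i v_i` or `u_i v_{i+k}` according to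
parity. -/
structure IsRowMatching (k : ℕ) (ρ : ZMod n →+* ZMod d) (P : AccordionWeight n) : Prop
    extends P.IsPerfect k where
  u_eq : ∀ i, ρ i = -1 → P.u i = 1
  v_eq : ∀ i, ρ i = -1 → P.v i = 1
  x_eq : ∀ i, ρ i ≠ 0 → ρ i ≠ -1 → Odd (ρ i).val → P.x i = 1
  y_eq : ∀ i, ρ i ≠ 0 → ρ i ≠ -1 → Even (ρ i).val → P.y i = 1

theorem map_sub_val [NeZero d] (ρ : ZMod n →+* ZMod d) (i : ZMod n) :
    ρ (i - ((ρ i).val : ZMod n)) = 0 := by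
  simp

theorem map_sub_one {s : ZMod n} (hs : ρ s = 0) : ρ (s - 1) = -1 := by simp [hs]

theorem val_map_add {s : ZMod n} (hs : ρ s = 0) {r : ℕ} (hr : r < d) : (ρ (s + r)).val = r := by
  rw [map_add, hs, zero_add, map_natCast, ZMod.val_natCast_of_lt hr]

theorem map_add_sub_one {s : ZMod n} (hs : ρ s = 0) : ρ (s + d - 1) = -1 := by simp [hs]

theorem IsRowMatching.u_right (hP : P.IsRowMatching k ρ) (hQ : Q.IsPerfect k) (hPQ : P.Disjoint Q)
    {i : ZMod n} (hi : ρ i = -1) : Q.u i = 0 := by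
  have := hP.u_eq i hi
  have := hPQ.u i
  have := hQ.u_nonneg i
  omega

theorem IsRowMatching.v_right (hP : P.IsRowMatching k ρ) (hQ : Q.IsPerfect k) (hPQ : P.Disjoint Q)
    {i : ZMod n} (hi : ρ i = -1) : Q.v i = 0 := by
  have := hP.v_eq i hi
  have := hPQ.v i
  have := hQ.v_nonneg i
  omega

theorem IsRowMatching.top_u (hP : P.IsRowMatching k ρ) (hQ : Q.IsPerfect k)
    (hPQ : P.Disjoint Q) {s : ZMod n} (hs : ρ s = 0) :
    heightB P Q s d - heightA P Q s d = -(-1) ^ d := by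
  have h := map_sub_one hs
  have h' := map_add_sub_one hs
  rw [heightB_sub_heightA hP.toIsPerfect hQ (hP.u_eq _ h) (hP.u_right hQ hPQ h),
    hP.u_eq _ h', hP.u_right hQ hPQ h']
  ring

theorem IsRowMatching.top_v (hP : P.IsRowMatching k ρ) (hQ : Q.IsPerfect k)
    (hPQ : P.Disjoint Q) {s : ZMod n} (hs : ρ s = 0) :
    heightA P Q (s - k) d - heightB P Q s d = (-1) ^ d := by
  have h := map_sub_one hs
  have h' := map_add_sub_one hs
  rw [heightA_sub_heightB hP.toIsPerfect hQ (hP.v_eq _ h) (hP.v_right hQ hPQ h),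
    hP.v_eq _ h', hP.v_right hQ hPQ h']
  ring

theorem IsRowMatching.heightA_top (hP : P.IsRowMatching k ρ) (hQ : Q.IsPerfect k)
    (hPQ : P.Disjoint Q) {s : ZMod n} (hs : ρ s = 0) :
    heightA P Q (s - k) d = heightA P Q s d := by
  linarith [hP.top_u hQ hPQ hs, hP.top_v hQ hPQ hs]

/-- The least height above the last row in the columns at `u_s`. -/
def topLevel (P Q : AccordionWeight n) (d : ℕ) (s : ZMod n) : ℤ :=
  min (heightB P Q s d) (heightA P Q s d)

theorem IsRowMatching.topLevel_sub (hP : P.IsRowMatching k ρ) (hQ : Q.IsPerfect k)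
    (hPQ : P.Disjoint Q) (hk : ρ k = 0) {s : ZMod n} (hs : ρ s = 0) :
    topLevel P Q d (s - k) = topLevel P Q d s := by
  have h := hP.heightA_top hQ hPQ hs
  have h1 := hP.top_u hQ hPQ hs
  have h2 := hP.top_u hQ hPQ (s := s - k) (by rw [map_sub, hs, hk, sub_zero])
  rw [topLevel, topLevel, h, show heightB P Q (s - k) d = heightB P Q s d by linarith]

theorem IsRowMatching.topLevel_natCast_mul (hP : P.IsRowMatching k ρ) (hQ : Q.IsPerfect k)
    (hPQ : P.Disjoint Q) (hk : ρ k = 0) (t : ℕ) :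
    topLevel P Q d (t * k) = topLevel P Q d 0 := by
  induction t with
  | zero => simp
  | succ t ih =>
    rw [← ih, ← hP.topLevel_sub hQ hPQ hk (by rw [map_mul, hk, mul_zero])]
    congr 1
    push_cast
    ring

theorem level_u [NeZero d] (hP : P.IsRowMatching k ρ) (hQ : Q.IsPerfect k) (hPQ : P.Disjoint Q)
    {i s : ZMod n} {r : ℕ} (hr : (ρ i).val = r) (hs : s + r = i) :
    (P.x i + Q.x i = 1 →
      level P Q k d ρ (false, i) = min (heightB P Q s r) (heightB P Q s (r + 1))) ∧
    (P.y i + Q.y i = 1 →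
      level P Q k d ρ (false, i) = min (heightA P Q s r) (heightA P Q s (r + 1))) ∧
    (P.u i + Q.u i = 1 → level P Q k d ρ (false, i) =
      min (heightB P Q s (r + 1)) (heightA P Q s (r + 1))) ∧
    (P.u (i - 1) + Q.u (i - 1) = 1 → level P Q k d ρ (false, i) =
      min (heightB P Q s r) (heightA P Q s r)) := by
  have hρ : ρ s = 0 := by
    have := map_sub_val ρ i
    rwa [hr, ← hs, add_sub_cancel_right] at this
  have h1 := hP.u_eq _ (map_sub_one hρ)
  have h2 := hP.u_right hQ hPQ (map_sub_one hρ)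
  have h3 := heightB_sub_heightA hP.toIsPerfect hQ h1 h2 r
  have h4 := heightB_sub_heightA hP.toIsPerfect hQ h1 h2 (r + 1)
  have e : s + ((r + 1 : ℕ) : ZMod n) - 1 = i := by rw [← hs]; push_cast; ring
  rw [hs] at h3
  rw [e, pow_succ] at h4
  have hl : level P Q k d ρ (false, i) = min (min (heightB P Q s r) (heightA P Q s r))
      (min (heightB P Q s (r + 1)) (heightA P Q s (r + 1))) := by
    simp only [level, hr, show i - (r : ZMod n) = s by rw [← hs, add_sub_cancel_right]]
  rw [hl]
  refine min_heights (neg_one_pow_eq_or ℤ r) (hP.x_nonneg i) (hP.y_nonneg i) (hP.u_nonneg i)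
    (hP.u_nonneg (i - 1)) (hQ.x_nonneg i) (hQ.y_nonneg i) (hQ.u_nonneg i) (hQ.u_nonneg (i - 1))
    (hP.sum_u i) (hQ.sum_u i) ?_ ?_ ?_ h3
  · rw [heightB, Finset.sum_range_succ, hs, heightB]; ring
  · rw [heightA, Finset.sum_range_succ, hs, heightA]; ring
  · rw [h4]; ring

theorem level_v [NeZero d] (hP : P.IsRowMatching k ρ) (hQ : Q.IsPerfect k) (hPQ : P.Disjoint Q)
    {i s : ZMod n} {r : ℕ} (hr : (ρ i).val = r) (hs : s + r = i) :
    (P.y (i - k) + Q.y (i - k) = 1 → level P Q k d ρ (true, i) =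
      min (heightA P Q (s - k) r) (heightA P Q (s - k) (r + 1))) ∧
    (P.x i + Q.x i = 1 →
      level P Q k d ρ (true, i) = min (heightB P Q s r) (heightB P Q s (r + 1))) ∧
    (P.v i + Q.v i = 1 → level P Q k d ρ (true, i) =
      min (heightA P Q (s - k) (r + 1)) (heightB P Q s (r + 1))) ∧
    (P.v (i - 1) + Q.v (i - 1) = 1 → level P Q k d ρ (true, i) =
      min (heightA P Q (s - k) r) (heightB P Q s r)) := by
  have hρ : ρ s = 0 := by
    have := map_sub_val ρ i
    rwa [hr, ← hs, add_sub_cancel_right] at this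
  have h1 := hP.v_eq _ (map_sub_one hρ)
  have h2 := hP.v_right hQ hPQ (map_sub_one hρ)
  have h3 := heightA_sub_heightB hP.toIsPerfect hQ h1 h2 r
  have h4 := heightA_sub_heightB hP.toIsPerfect hQ h1 h2 (r + 1)
  have e : s + ((r + 1 : ℕ) : ZMod n) - 1 = i := by rw [← hs]; push_cast; ring
  have e' : s - (k : ZMod n) + r = i - k := by rw [← hs]; ring
  rw [hs] at h3
  rw [e, pow_succ] at h4
  have hl : level P Q k d ρ (true, i) = min (min (heightA P Q (s - k) r) (heightB P Q s r))
      (min (heightA P Q (s - k) (r + 1)) (heightB P Q s (r + 1))) := by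
    simp only [level, hr, show i - (r : ZMod n) = s by rw [← hs, add_sub_cancel_right]]
  rw [hl]
  have hsP := hP.sum_v i
  have hsQ := hQ.sum_v i
  have he : -(-1 : ℤ) ^ r = 1 ∨ -(-1 : ℤ) ^ r = -1 := by
    rcases neg_one_pow_eq_or ℤ r with h | h <;> simp [h]
  refine min_heights he (hP.y_nonneg (i - k)) (hP.x_nonneg i) (hP.v_nonneg i)
    (hP.v_nonneg (i - 1)) (hQ.y_nonneg (i - k)) (hQ.x_nonneg i) (hQ.v_nonneg i)
    (hQ.v_nonneg (i - 1)) (by omega) (by omega) ?_ ?_ ?_ ?_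
  · rw [heightA, Finset.sum_range_succ, e', heightA]; ring
  · rw [heightB, Finset.sum_range_succ, hs, heightB]; ring
  · rw [h4]; ring
  · rw [h3]; ring

variable [NeZero d]

theorem eq_neg_one_iff_val_add_one {a : ZMod d} : a = -1 ↔ a.val + 1 = d := by
  rw [eq_neg_iff_add_eq_zero]
  conv_lhs => rw [← ZMod.natCast_zmod_val a]
  rw [← Nat.cast_succ, ZMod.natCast_eq_zero_iff]
  have := ZMod.val_lt a
  exact ⟨fun h => le_antisymm this (Nat.le_of_dvd (Nat.succ_pos _) h), fun h => h.symm.dvd⟩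

theorem IsPerfect.le_one (hQ : Q.IsPerfect k) (i : ZMod n) : Q.x i ≤ 1 ∧ Q.y i ≤ 1 := by
  have := hQ.sum_u i
  have := hQ.x_nonneg i
  have := hQ.y_nonneg i
  have := hQ.u_nonneg i
  have := hQ.u_nonneg (i - 1)
  omega

theorem IsPerfect.x_y_eq_zero (hP : P.IsPerfect k) {i : ZMod n} (h : P.u i = 1 ∨ P.u (i - 1) = 1) :
    P.x i = 0 ∧ P.y i = 0 := by
  have := hP.sum_u i
  have := hP.x_nonneg i
  have := hP.y_nonneg i
  have := hP.u_nonneg i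
  have := hP.u_nonneg (i - 1)
  omega

/-- In an inner row the height increases by one in columns of one parity and does not decrease in
the others. -/
theorem IsRowMatching.height_inner_row (hP : P.IsRowMatching k ρ) (hQ : Q.IsPerfect k)
    (hPQ : P.Disjoint Q) {s : ZMod n} (hs : ρ s = 0) {r : ℕ} (h0 : r ≠ 0) (hd : r + 1 < d) :
    (Odd r → heightB P Q s (r + 1) = heightB P Q s r + 1 ∧
      heightA P Q s r ≤ heightA P Q s (r + 1)) ∧
    (Even r → heightB P Q s r ≤ heightB P Q s (r + 1) ∧
      heightA P Q s (r + 1) = heightA P Q s r + 1) := by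
  have hv := val_map_add (ρ := ρ) hs (show r < d by omega)
  have n0 : ρ (s + r) ≠ 0 := fun h => h0 (by rw [← hv, h, ZMod.val_zero])
  have n1 : ρ (s + r) ≠ -1 := fun h => by rw [eq_neg_one_iff_val_add_one, hv] at h; omega
  have hx := hP.x_eq _ n0 n1
  have hy := hP.y_eq _ n0 n1
  rw [hv] at hx hy
  have h1 := hP.sum_u (s + r)
  have h2 := hP.x_nonneg (s + r)
  have h3 := hP.y_nonneg (s + r)
  have h4 := hP.u_nonneg (s + r)
  have h5 := hP.u_nonneg (s + r - 1)
  have h6 := hQ.x_nonneg (s + r)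
  have h7 := hQ.y_nonneg (s + r)
  have h8 := hPQ.x (s + r)
  have h9 := hPQ.y (s + r)
  simp only [heightA, heightB, Finset.sum_range_succ]
  constructor <;> intro h
  · have := hx h
    rw [h.neg_one_pow]
    omega
  · have := hy h
    rw [h.neg_one_pow]
    omega

theorem IsRowMatching.height_lower (hP : P.IsRowMatching k ρ) (hQ : Q.IsPerfect k)
    (hPQ : P.Disjoint Q) {s : ZMod n} (hs : ρ s = 0) (r : ℕ) (hr : r + 1 < d) :
    ((r + 1) / 2 : ℕ) ≤ heightB P Q s (r + 1) ∧
      1 - Q.y s + (r / 2 : ℕ) ≤ heightA P Q s (r + 1) := by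
  induction r with
  | zero =>
    have h := hP.x_y_eq_zero (Or.inr (hP.u_eq _ (map_sub_one hs)))
    have := hQ.x_nonneg s
    simp only [heightA, heightB, Finset.sum_range_succ, Finset.sum_range_zero, Nat.cast_zero,
      add_zero, h, pow_zero]
    omega
  | succ r ih =>
    have ih := ih (by omega)
    obtain ⟨ho, he⟩ := hP.height_inner_row hQ hPQ hs (show r + 1 ≠ 0 by omega) hr
    rcases Nat.even_or_odd (r + 1) with h | h
    · have := he h
      rw [Nat.even_iff] at h
      omega
    · have := ho h
      rw [Nat.odd_iff] at h
      omega

theorem IsRowMatching.two_le_topLevel_or (hP : P.IsRowMatching k ρ) (hQ : Q.IsPerfect k)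
    (hPQ : P.Disjoint Q) (hd : 6 ≤ d) {s : ZMod n} (hs : ρ s = 0) :
    2 ≤ topLevel P Q d s ∨ (Q.y s = 1 ∧ Q.x (s + d - 1) = 1) := by
  obtain ⟨m, rfl⟩ : ∃ m, d = m + 2 := ⟨d - 2, by omega⟩
  obtain ⟨hB, hA⟩ := hP.height_lower hQ hPQ hs m (by omega)
  have e : s + ((m + 1 : ℕ) : ZMod n) = s + ((m + 2 : ℕ) : ZMod n) - 1 := by push_cast; ring
  have h' := map_add_sub_one hs
  have hz := hP.x_y_eq_zero (Or.inl (hP.u_eq _ h'))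
  have htop := hP.top_u hQ hPQ hs
  have hBs : heightB P Q s (m + 2) = heightB P Q s (m + 1) +
      (-1) ^ (m + 1) * Q.x (s + ((m + 2 : ℕ) : ZMod n) - 1) := by
    simp only [heightB, Finset.sum_range_succ _ (m + 1), e, hz]
    ring
  have hAs : heightA P Q s (m + 2) = heightA P Q s (m + 1) -
      (-1) ^ (m + 1) * Q.y (s + ((m + 2 : ℕ) : ZMod n) - 1) := by
    simp only [heightA, Finset.sum_range_succ _ (m + 1), e, hz]
    ring
  have := hQ.le_one s
  have := hQ.le_one (s + ((m + 2 : ℕ) : ZMod n) - 1)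
  have := hQ.x_nonneg (s + ((m + 2 : ℕ) : ZMod n) - 1)
  have := hQ.y_nonneg (s + ((m + 2 : ℕ) : ZMod n) - 1)
  rw [topLevel]
  rcases Nat.even_or_odd m with h | h
  · rw [h.add_one.neg_one_pow] at hBs hAs
    rw [(h.add even_two).neg_one_pow] at htop
    rw [Nat.even_iff] at h
    omega
  · rw [h.add_one.neg_one_pow] at hBs hAs
    rw [(h.add_even even_two).neg_one_pow] at htop
    rw [Nat.odd_iff] at h
    omega

theorem not_spanning_of_two_le_topLevel (hP : P.IsRowMatching k ρ) (hQ : Q.IsPerfect k)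
    (hPQ : P.Disjoint Q) (hk : ρ k = 0) (hT : ∀ s, ρ s = 0 → 2 ≤ topLevel P Q d s) :
    ¬ Spanning k P Q := by
  intro hS
  have hval : ∀ i, ρ i ≠ -1 → (ρ (i + 1)).val = (ρ i).val + 1 := by
    intro i hi
    have := ZMod.val_lt (ρ i)
    have h := val_map_add (map_sub_val ρ i) (r := (ρ i).val + 1)
      (by rw [Ne, eq_neg_one_iff_val_add_one] at hi; omega)
    rw [← h]
    congr 2
    push_cast
    ring
  have hs : ∀ i : ZMod n, i - ((ρ i).val : ZMod n) + ((ρ i).val : ZMod n) = i := fun i => by ring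
  have hbot : ∀ i, ρ i = -1 → (ρ (i + 1)).val = 0 := fun i hi => by simp [hi]
  have key := hS (fun a => level P Q k d ρ a ≠ 1) ⟨(false, 0), ?_⟩ ?_ ?_ ?_ ?_
  · have h0 : heightB P Q 0 0 ≤ 1 := by simp [heightB]
    have hd : 2 ≤ heightB P Q 0 d := (hT 0 (map_zero ρ)).trans (min_le_left _ _)
    obtain ⟨j, hj, h1, h2⟩ := exists_eq_one_of_steps h0 hd (fun j => by
      have h1 := hQ.le_one (0 + j)
      have h2 := hP.le_one (0 + j)
      have h3 := hP.x_nonneg (0 + j)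
      have h4 := hQ.x_nonneg (0 + j)
      simp only [heightB, Finset.sum_range_succ]
      rcases neg_one_pow_eq_or ℤ j with h | h <;> rw [h] <;> omega)
    have hx : P.x j + Q.x j = 1 := by
      have h3 := hP.x_nonneg j
      have h4 := hQ.x_nonneg j
      have h5 := hPQ.x j
      have : heightB P Q 0 (j + 1) = heightB P Q 0 j - (-1) ^ j * (P.x j - Q.x j) := by
        simp only [heightB, Finset.sum_range_succ, zero_add]
        ring
      rcases neg_one_pow_eq_or ℤ j with h | h <;> rw [h] at this <;> omega
    refine key (false, j) ?_
    rw [(level_u hP hQ hPQ (i := (j : ZMod n)) (s := 0) (r := j)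
      (by simpa using val_map_add (map_zero ρ) hj) (zero_add _)).1 hx, h1, h2]
    rfl
  · have h := map_sub_one (map_zero ρ)
    have h0 : P.u (0 - 1) + Q.u (0 - 1) = 1 := by rw [hP.u_eq _ h, hP.u_right hQ hPQ h, add_zero]
    rw [(level_u hP hQ hPQ (i := 0) (s := 0) (r := 0) (by simp) (by simp)).2.2.2 h0]
    simp [heightA, heightB]
  · intro i h
    rw [(level_u hP hQ hPQ rfl (hs i)).1 h, (level_v hP hQ hPQ rfl (hs i)).2.1 h]
  · intro i h
    have e : i - ((ρ i).val : ZMod n) + k + ((ρ i).val : ZMod n) = i + k := by ring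
    have hv : (ρ (i + k)).val = (ρ i).val := by rw [map_add, hk, add_zero]
    rw [(level_u hP hQ hPQ rfl (hs i)).2.1 h, (level_v hP hQ hPQ hv e).1 (by simpa using h),
      add_sub_cancel_right]
  · intro i h
    rw [(level_u hP hQ hPQ rfl (hs i)).2.2.1 h]
    by_cases hi : ρ i = -1
    · have := hT _ (map_sub_val ρ i)
      rw [(level_u hP hQ hPQ (hbot i hi) (s := i + 1) (by simp)).2.2.2 (by simpa using h),
        eq_neg_one_iff_val_add_one.1 hi, ← topLevel]
      simp only [heightA, heightB, Finset.sum_range_zero]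
      constructor <;> intro <;> omega
    · have e : i - ((ρ i).val : ZMod n) + ((ρ i).val + 1 : ℕ) = i + 1 := by push_cast; ring
      rw [(level_u hP hQ hPQ (hval i hi) e).2.2.2 (by simpa using h)]
  · intro i h
    rw [(level_v hP hQ hPQ rfl (hs i)).2.2.1 h]
    by_cases hi : ρ i = -1
    · have := hT _ (map_sub_val ρ i)
      rw [(level_v hP hQ hPQ (hbot i hi) (s := i + 1) (by simp)).2.2.2 (by simpa using h),
        eq_neg_one_iff_val_add_one.1 hi, hP.heightA_top hQ hPQ (map_sub_val ρ i), min_comm,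
        ← topLevel]
      simp only [heightA, heightB, Finset.sum_range_zero]
      constructor <;> intro <;> omega
    · have e : i - ((ρ i).val : ZMod n) + ((ρ i).val + 1 : ℕ) = i + 1 := by push_cast; ring
      rw [(level_v hP hQ hPQ (hval i hi) e).2.2.2 (by simpa using h)]

/-- If the topmost and bottommost rows are matched by `Q` inside themselves, they form a proper
closed set of vertices. -/
theorem not_spanning_of_rows_closed (hP : P.IsRowMatching k ρ) (hQ : Q.IsPerfect k)
    (hd : 3 ≤ d) (hk : ρ k = 0) (hy : ∀ s, ρ s = 0 → Q.y s = 1)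
    (hx : ∀ s, ρ s = -1 → Q.x s = 1) : ¬ Spanning k P Q := by
  intro hS
  have hrow : ∀ i : ZMod n, (ρ i ≠ -1 → ρ i ≠ 0 ∧ ρ (i + 1) ≠ -1) →
      ((ρ i = 0 ∨ ρ i = -1) ↔ (ρ (i + 1) = 0 ∨ ρ (i + 1) = -1)) := by
    intro i h
    have h0 : ρ (i + 1) = 0 ↔ ρ i = -1 := by
      rw [map_add, map_one, eq_neg_iff_add_eq_zero]
    tauto
  have key := hS (fun a => ρ a.2 = 0 ∨ ρ a.2 = -1) ⟨(false, 0), Or.inl (map_zero ρ)⟩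
    (fun i _ => Iff.rfl) (fun i _ => by simp [hk])
    (fun i h => hrow i fun hi => ⟨fun h0 => ?_, fun h1 => ?_⟩)
    (fun i h => hrow i fun hi => ⟨fun h0 => ?_, fun h1 => ?_⟩) (false, 1)
  · have := ZMod.val_one'' (show d ≠ 1 by omega)
    simp only [map_one, eq_neg_one_iff_val_add_one, ← ZMod.val_eq_zero, this] at key
    omega
  · have := hP.u_eq _ (map_sub_one h0)
    have := hy i h0
    have := hP.sum_u i
    have := hQ.sum_u i
    have := hP.x_nonneg i
    have := hP.y_nonneg i
    have := hP.u_nonneg i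
    have := hQ.x_nonneg i
    have := hQ.u_nonneg (i - 1)
    omega
  · have := hP.u_eq _ h1
    have := hx _ h1
    have h2 := hP.sum_u (i + 1)
    have h3 := hQ.sum_u (i + 1)
    have := hP.x_nonneg (i + 1)
    have := hP.y_nonneg (i + 1)
    have := hP.u_nonneg i
    have := hQ.y_nonneg (i + 1)
    have := hQ.u_nonneg (i + 1)
    rw [add_sub_cancel_right] at h2 h3
    omega
  · have := hP.v_eq _ (map_sub_one h0)
    have := hy (i - k) (by rw [map_sub, h0, hk, sub_zero])
    have := hP.sum_v i
    have := hQ.sum_v i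
    have := hP.x_nonneg i
    have := hP.y_nonneg (i - k)
    have := hP.v_nonneg i
    have := hQ.x_nonneg i
    have := hQ.v_nonneg (i - 1)
    omega
  · have := hP.v_eq _ h1
    have := hx _ h1
    have h2 := hP.sum_v (i + 1)
    have h3 := hQ.sum_v (i + 1)
    have := hP.x_nonneg (i + 1)
    have := hP.y_nonneg (i + 1 - k)
    have := hP.v_nonneg i
    have := hQ.y_nonneg (i + 1 - k)
    have := hQ.v_nonneg (i + 1)
    rw [add_sub_cancel_right] at h2 h3
    omega

theorem IsRowMatching.not_spanning (hP : P.IsRowMatching k ρ) (hQ : Q.IsPerfect k)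
    (hPQ : P.Disjoint Q) (hd : 6 ≤ d) (hk : ρ k = 0)
    (hker : ∀ s, ρ s = 0 → ∃ t : ℕ, s = t * k) : ¬ Spanning k P Q := by
  have hconst : ∀ s, ρ s = 0 → topLevel P Q d s = topLevel P Q d 0 := fun s hs => by
    obtain ⟨t, rfl⟩ := hker s hs
    exact hP.topLevel_natCast_mul hQ hPQ hk t
  by_cases hT : 2 ≤ topLevel P Q d 0
  · exact not_spanning_of_two_le_topLevel hP hQ hPQ hk fun s hs => (hconst s hs).symm ▸ hT
  · have h : ∀ s, ρ s = 0 → Q.y s = 1 ∧ Q.x (s + d - 1) = 1 := fun s hs =>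
      (hP.two_le_topLevel_or hQ hPQ hd hs).resolve_left (hconst s hs ▸ hT)
    refine not_spanning_of_rows_closed hP hQ (by omega) hk (fun s hs => (h s hs).1) fun s hs => ?_
    have := (h (s + 1 - d) (by simp [hs])).2
    rwa [sub_add_cancel, add_sub_cancel_right] at this

end Core

section Graph

variable {n k : ℕ}

theorem accordion_adj_u {i : ZMod n} {b : Bool × ZMod n} (h : (accordion n k).Adj (false, i) b) :
    b = (true, i) ∨ b = (true, i + k) ∨ b = (false, i + 1) ∨ b = (false, i - 1) := by
  obtain ⟨b, j⟩ := b
  rw [accordion, SimpleGraph.fromRel_adj] at h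
  cases b <;> simp_all [eq_sub_iff_add_eq, eq_comm]

theorem accordion_adj_v {i : ZMod n} {b : Bool × ZMod n} (h : (accordion n k).Adj (true, i) b) :
    b = (false, i) ∨ b = (false, i - k) ∨ b = (true, i + 1) ∨ b = (true, i - 1) := by
  obtain ⟨b, j⟩ := b
  rw [accordion, SimpleGraph.fromRel_adj] at h
  cases b <;> simp_all [eq_sub_iff_add_eq, eq_comm]

open Classical in
/-- The indicator weight of a subgraph of an accordion graph. -/
noncomputable def subgraphWeight (M : (accordion n k).Subgraph) : AccordionWeight n where
  x i := if M.Adj (false, i) (true, i) then 1 else 0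
  y i := if M.Adj (false, i) (true, i + k) then 1 else 0
  u i := if M.Adj (false, i) (false, i + 1) then 1 else 0
  v i := if M.Adj (true, i) (true, i + 1) then 1 else 0

theorem existsUnique_adj {V : Type*} {G : SimpleGraph V} {M : G.Subgraph}
    (hM : M.IsPerfectMatching) (a : V) : ∃ w, ∀ b, M.Adj a b ↔ b = w := by
  obtain ⟨w, hw, h⟩ := SimpleGraph.Subgraph.isPerfectMatching_iff.1 hM a
  exact ⟨w, fun b => ⟨h b, fun hb => hb ▸ hw⟩⟩

theorem add_one_ne_sub_one (hn : 3 ≤ n) (i : ZMod n) : i + 1 ≠ i - 1 := by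
  intro h
  have h2 : ((2 : ℕ) : ZMod n) = 0 := by
    push_cast
    linear_combination h
  rw [ZMod.natCast_eq_zero_iff] at h2
  exact absurd (Nat.le_of_dvd two_pos h2) (by omega)

theorem isPerfect_subgraphWeight (hn : 3 ≤ n) (hk : (k : ZMod n) ≠ 0)
    {M : (accordion n k).Subgraph} (hM : M.IsPerfectMatching) :
    (subgraphWeight M).IsPerfect k where
  x_nonneg i := by rw [subgraphWeight]; positivity
  y_nonneg i := by rw [subgraphWeight]; positivity
  u_nonneg i := by rw [subgraphWeight]; positivity
  v_nonneg i := by rw [subgraphWeight]; positivity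
  sum_u i := by
    obtain ⟨w, hw⟩ := existsUnique_adj hM (false, i)
    have h := add_one_ne_sub_one hn i
    have hw' := accordion_adj_u (M.adj_sub ((hw w).2 rfl))
    simp only [subgraphWeight, sub_add_cancel, M.adj_comm (false, i - 1), hw]
    rcases hw' with rfl | rfl | rfl | rfl <;> simp [hk, h, h.symm]
  sum_v i := by
    obtain ⟨w, hw⟩ := existsUnique_adj hM (true, i)
    have h := add_one_ne_sub_one hn i
    have hw' := accordion_adj_v (M.adj_sub ((hw w).2 rfl))
    have hx : M.Adj (false, i) (true, i) ↔ (false, i) = w := by rw [M.adj_comm, hw]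
    have hy : M.Adj (false, i - k) (true, i - k + k) ↔ (false, i - k) = w := by
      rw [sub_add_cancel, M.adj_comm, hw]
    have hv : M.Adj (true, i - 1) (true, i - 1 + 1) ↔ (true, i - 1) = w := by
      rw [sub_add_cancel, M.adj_comm, hw]
    have hik : i ≠ i - k := fun h => hk (sub_eq_self.1 h.symm)
    simp only [subgraphWeight, hx, hy, hv, hw]
    rcases hw' with rfl | rfl | rfl | rfl <;> simp [hik, hik.symm, h, h.symm]

/-- A nonempty set of vertices closed under the edges of a Hamiltonian cycle is everything. -/
theorem forall_of_isHamiltonianCycle {V : Type*} [DecidableEq V] {G : SimpleGraph V} {v : V}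
    {c : G.Walk v v} (hc : c.IsHamiltonianCycle) {S : V → Prop} (hS : ∃ a, S a)
    (h : ∀ a b, s(a, b) ∈ c.edges → (S a ↔ S b)) (a : V) : S a := by
  have key : ∀ {x y : V} (p : G.Walk x y), (∀ a b, s(a, b) ∈ p.edges → (S a ↔ S b)) →
      ∀ z ∈ p.support, (S x ↔ S z) := by
    intro x y p
    induction p with
    | nil => simp
    | cons hadj p ih =>
      intro hp z hz
      rw [SimpleGraph.Walk.support_cons, List.mem_cons] at hz
      rcases hz with rfl | hz
      · rfl
      · refine (hp _ _ (by simp)).trans (ih (fun a b hab => hp a b ?_) z hz)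
        simp [hab]
  obtain ⟨b, hb⟩ := hS
  exact (key c h a (hc.mem_support a)).1 ((key c h b (hc.mem_support b)).2 hb)

theorem not_adj_of_adj (hn : 3 ≤ n) {M N : (accordion n k).Subgraph} (hM : M.IsPerfectMatching)
    (hN : N.IsPerfectMatching)
    (hspan : ∀ S : Bool × ZMod n → Prop, (∃ a, S a) →
      (∀ a b, M.Adj a b ∨ N.Adj a b → (S a ↔ S b)) → ∀ a, S a)
    {a b : Bool × ZMod n} (h : M.Adj a b) : ¬ N.Adj a b := by
  intro h'
  have hab := hspan (fun c => c = a ∨ c = b) ⟨a, Or.inl rfl⟩ fun c e hce => by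
    obtain ⟨w, hw⟩ := existsUnique_adj hM a
    obtain ⟨w', hw'⟩ := existsUnique_adj hN a
    obtain ⟨z, hz⟩ := existsUnique_adj hM b
    obtain ⟨z', hz'⟩ := existsUnique_adj hN b
    have := hw b
    have := hw' b
    have := hz a
    have := hz' a
    have := M.adj_comm
    have := N.adj_comm
    grind
  have : Fact (1 < n) := ⟨by omega⟩
  have h0 := hab (false, 0)
  have h1 := hab (false, 1)
  have h2 := hab (true, 0)
  have h3 := hab (true, 1)
  have : (0 : ZMod n) ≠ 1 := zero_ne_one
  grind

theorem disjoint_subgraphWeight {M N : (accordion n k).Subgraph}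
    (h : ∀ a b, M.Adj a b → ¬ N.Adj a b) :
    (subgraphWeight M).Disjoint (subgraphWeight N) := by
  constructor <;> intro i <;> simp only [subgraphWeight] <;> split_ifs <;> simp_all

theorem spanning_subgraphWeight {M N : (accordion n k).Subgraph}
    (h : ∀ a b, M.Adj a b → ¬ N.Adj a b)
    (hspan : ∀ S : Bool × ZMod n → Prop, (∃ a, S a) →
      (∀ a b, M.Adj a b ∨ N.Adj a b → (S a ↔ S b)) → ∀ a, S a) :
    (subgraphWeight M).Spanning k (subgraphWeight N) := by
  classical
  intro S hS hx hy hu hv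
  have hone : ∀ a b, M.Adj a b ∨ N.Adj a b →
      ∀ [Decidable (M.Adj a b)] [Decidable (N.Adj a b)],
      (if M.Adj a b then (1 : ℤ) else 0) + (if N.Adj a b then 1 else 0) = 1 := by
    intro a b hab _ _
    rcases hab with hM | hN
    · simp [hM, h a b hM]
    · have hM : ¬ M.Adj a b := fun hM => h a b hM hN
      simp [hN, hM]
  have hrel : ∀ a b : Bool × ZMod n, ((a.1 = b.1 ∧ b.2 = a.2 + 1) ∨
      (a.1 = false ∧ b.1 = true ∧ (b.2 = a.2 ∨ b.2 = a.2 + (k : ZMod n)))) →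
      M.Adj a b ∨ N.Adj a b → (S a ↔ S b) := by
    rintro ⟨a, i⟩ ⟨b, j⟩ hr hab
    dsimp only at hr
    rcases hr with ⟨rfl, rfl⟩ | ⟨rfl, rfl, rfl | rfl⟩
    · cases a
      · exact hu i (hone _ _ hab)
      · exact hv i (hone _ _ hab)
    · exact hx j (hone _ _ hab)
    · exact hy i (hone _ _ hab)
  refine hspan S hS fun a b hab => ?_
  have hadj : (accordion n k).Adj a b := hab.elim (fun h => M.adj_sub h) fun h => N.adj_sub h
  rw [accordion, SimpleGraph.fromRel_adj] at hadj
  rcases hadj.2 with hr | hr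
  · exact hrel a b hr hab
  · exact (hrel b a hr (hab.imp (fun h => h.symm) fun h => h.symm)).symm

variable {d : ℕ}

/-- The partner of each vertex in the perfect matching that joins row `-1` to row `0` and matches
every other row within itself, the two ways alternating with the parity of the row. -/
def rowPartner (k : ℕ) (ρ : ZMod n →+* ZMod d) : Bool × ZMod n → Bool × ZMod n
  | (b, i) =>
    if ρ i = 0 then (b, i - 1)
    else if ρ i = -1 then (b, i + 1)
    else if Even (ρ i).val then (!b, if b then i - k else i + k)
    else (!b, i)

theorem rowPartner_rowPartner (hd : 2 ≤ d) {ρ : ZMod n →+* ZMod d} (hk : ρ k = 0)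
    (a : Bool × ZMod n) : rowPartner k ρ (rowPartner k ρ a) = a := by
  have : Fact (1 < d) := ⟨hd⟩
  obtain ⟨b, i⟩ := a
  by_cases h0 : ρ i = 0
  · simp [rowPartner, h0]
  by_cases h1 : ρ i = -1
  · simp [rowPartner, h1]
  by_cases h2 : Even (ρ i).val
  · cases b <;> simp [rowPartner, h0, h1, h2, hk]
  · simp [rowPartner, h0, h1, h2]

theorem accordion_adj_rowPartner (hn : 3 ≤ n) (ρ : ZMod n →+* ZMod d) (a : Bool × ZMod n) :
    (accordion n k).Adj a (rowPartner k ρ a) := by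
  have : Fact (1 < n) := ⟨by omega⟩
  obtain ⟨b, i⟩ := a
  rw [accordion, SimpleGraph.fromRel_adj]
  by_cases h0 : ρ i = 0
  · have h : i ≠ i - 1 := fun h => one_ne_zero (sub_eq_self.1 h.symm)
    simp [rowPartner, h0, h]
  by_cases h1 : ρ i = -1
  · have h : (1 : ZMod d) ≠ 0 := neg_ne_zero.1 (h1 ▸ h0)
    simp [rowPartner, h1, h]
  by_cases h2 : Even (ρ i).val
  · cases b <;> simp [rowPartner, h0, h1, h2]
  · cases b <;> simp [rowPartner, h0, h1, h2]

/-- The perfect matching given by `rowPartner`. -/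
def rowMatching (hn : 3 ≤ n) (hd : 2 ≤ d) {ρ : ZMod n →+* ZMod d} (hk : ρ k = 0) :
    (accordion n k).Subgraph where
  verts := Set.univ
  Adj a b := rowPartner k ρ a = b
  adj_sub := by
    rintro a _ rfl
    exact accordion_adj_rowPartner hn ρ a
  edge_vert _ := Set.mem_univ _
  symm := ⟨by
    rintro a _ rfl
    exact rowPartner_rowPartner hd hk a⟩

theorem isPerfectMatching_rowMatching (hn : 3 ≤ n) (hd : 2 ≤ d) {ρ : ZMod n →+* ZMod d}
    (hk : ρ k = 0) : (rowMatching hn hd hk).IsPerfectMatching :=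
  SimpleGraph.Subgraph.isPerfectMatching_iff.2 fun a =>
    ⟨rowPartner k ρ a, rfl, fun b (h : rowPartner k ρ a = b) => h.symm⟩

theorem isRowMatching_rowMatching (hn : 3 ≤ n) (hkn : (k : ZMod n) ≠ 0) (hd : 2 ≤ d)
    {ρ : ZMod n →+* ZMod d} (hk : ρ k = 0) :
    (subgraphWeight (rowMatching hn hd hk)).IsRowMatching k ρ where
  toIsPerfect := isPerfect_subgraphWeight hn hkn (isPerfectMatching_rowMatching hn hd hk)
  u_eq i hi := by
    have : Fact (1 < d) := ⟨hd⟩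
    simp [subgraphWeight, rowMatching, rowPartner, hi]
  v_eq i hi := by
    have : Fact (1 < d) := ⟨hd⟩
    simp [subgraphWeight, rowMatching, rowPartner, hi]
  x_eq i h0 h1 h := by
    simp [subgraphWeight, rowMatching, rowPartner, h0, h1, Nat.not_even_iff_odd.2 h]
  y_eq i h0 h1 h := by
    simp [subgraphWeight, rowMatching, rowPartner, h0, h1, h]

theorem exists_eq_natCast_mul [NeZero n] (s : ZMod n)
    (hs : ZMod.castHom (Nat.gcd_dvd_left n k) (ZMod (n.gcd k)) s = 0) : ∃ t : ℕ, s = t * k := by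
  rw [← ZMod.natCast_zmod_val s, map_natCast, ZMod.natCast_eq_zero_iff] at hs
  obtain ⟨q, hq⟩ := hs
  have h : ((n.gcd k : ℤ) : ZMod n) = ((n * n.gcdA k + k * n.gcdB k : ℤ) : ZMod n) :=
    congrArg _ (Nat.gcd_eq_gcd_ab n k)
  push_cast at h
  rw [ZMod.natCast_self, zero_mul, zero_add] at h
  refine ⟨(n.gcdB k * q : ZMod n).val, ?_⟩
  rw [ZMod.natCast_zmod_val, ← ZMod.natCast_zmod_val s, hq, Nat.cast_mul, h]
  ring

end Graph

end AccordionWeight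

/-- If `gcd(n,k) ≥ 6`, the accordion graph `A[n,k]` does not have the PMH-property. -/
theorem accordion_not_isPMH_of_six_le_gcd (n k : ℕ) (hn : 3 ≤ n) (hk : 0 < k)
    (hkn : 2 * k ≤ n) (hgcd : 6 ≤ Nat.gcd n k) : ¬ IsPMH (accordion n k) := by
  intro hG
  have : NeZero n := ⟨by omega⟩
  have : NeZero (n.gcd k) := ⟨by omega⟩
  have hk0 : (k : ZMod n) ≠ 0 := by
    rw [Ne, ZMod.natCast_eq_zero_iff]
    exact fun h => absurd (Nat.le_of_dvd hk h) (by omega)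
  let ρ := ZMod.castHom (Nat.gcd_dvd_left n k) (ZMod (n.gcd k))
  have hρ : ρ k = 0 := by
    rw [map_natCast, ZMod.natCast_eq_zero_iff]
    exact Nat.gcd_dvd_right n k
  have hM := AccordionWeight.isPerfectMatching_rowMatching hn (by omega) hρ
  obtain ⟨N, hN, v, c, hc, hedges⟩ := hG _ hM
  have hspan : ∀ S : Bool × ZMod n → Prop, (∃ a, S a) →
      (∀ a b, (AccordionWeight.rowMatching hn (by omega) hρ).Adj a b ∨ N.Adj a b →
        (S a ↔ S b)) → ∀ a, S a := fun S hS h =>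
    AccordionWeight.forall_of_isHamiltonianCycle hc hS fun a b hab =>
      h a b (hedges.subset hab)
  have hdisj := fun a b => AccordionWeight.not_adj_of_adj hn hM hN hspan (a := a) (b := b)
  exact (AccordionWeight.isRowMatching_rowMatching hn hk0 (by omega) hρ).not_spanning
    (AccordionWeight.isPerfect_subgraphWeight hn hk0 hN)
    (AccordionWeight.disjoint_subgraphWeight hdisj) hgcd hρ
    AccordionWeight.exists_eq_natCast_mul
    (AccordionWeight.spanning_subgraphWeight hdisj hspan)
end

section
/- Let n and k be integers with n ≥ 3 and 0 < k ≤ n/2. If gcd(n,k) = 5, then the accordion graph A[n,k] does not have the PMH-property: there exists a perfect matching M of A[n,k] such that no perfect matching N of A[n,k] makes M ∪ N the edge set of a Hamiltonian cycle of A[n,k]. -/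
open SimpleGraph

/-- Exactly one of four propositions holds. -/
def ExactlyOne (p q r s : Prop) : Prop :=
  (p ∨ q ∨ r ∨ s) ∧ ¬(p ∧ q) ∧ ¬(p ∧ r) ∧ ¬(p ∧ s) ∧ ¬(q ∧ r) ∧ ¬(q ∧ s) ∧ ¬(r ∧ s)

/-- The edges of a perfect matching `N` of an accordion graph whose union with the column matching
is connected. Here `c` is the column (the residue modulo 5), `H s x` says that `N` contains the edge
from `(s, x)` to `(s, x + 1)`, `A x` that it contains `u_x v_x`, and `B s x` that it contains the
edge `u_y v_{y+k}` at the vertex `(s, x)`. -/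
structure ConnectedExtension {R : Type} [CommRing R] (c : R → ℕ) (k : R)
    (H B : Bool → R → Prop) (A : R → Prop) : Prop where
  col_lt : ∀ x, c x < 5
  col_add_one : ∀ x, c (x + 1) = (c x + 1) % 5
  col_add : ∀ x, c (x + k) = c x
  skew_iff : ∀ x, B true (x + k) ↔ B false x
  degree : ∀ s x, ExactlyOne (H s x) (H s (x - 1)) (A x) (B s x)
  not_straight : ∀ x, c x = 0 ∨ c x = 3 → ¬ A x
  not_horizontal : ∀ s x, c x = 1 → ¬ H s x
  not_skew : ∀ s x, c x = 4 → ¬ B s x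
  connected : ∀ P : Bool → R → Prop,
    (∀ s x, H s x ∨ c x = 1 → (P s x ↔ P s (x + 1))) →
    (∀ x, A x ∨ c x = 0 ∨ c x = 3 → (P false x ↔ P true x)) →
    (∀ x, B false x ∨ c x = 4 → (P false x ↔ P true (x + k))) →
    (∀ s x, P s x) ∨ ∀ s x, ¬ P s x

namespace ConnectedExtension

variable {R : Type} [CommRing R] {c : R → ℕ} {k : R} {H B : Bool → R → Prop} {A : R → Prop}

theorem col_sub_one (h : ConnectedExtension c k H B A) (x : R) : c (x - 1) = (c x + 4) % 5 := by
  have h1 := h.col_add_one (x - 1)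
  have := h.col_lt (x - 1)
  rw [sub_add_cancel] at h1
  omega

theorem col_cases (h : ConnectedExtension c k H B A) (x : R) :
    c x = 0 ∨ c x = 1 ∨ c x = 2 ∨ c x = 3 ∨ c x = 4 := by
  have := h.col_lt x
  omega

theorem exists_col_eq_one (h : ConnectedExtension c k H B A) : ∃ x, c x = 1 := by
  have hadd := h.col_add_one
  rcases h.col_cases 0 with e | e | e | e | e
  exacts [⟨0 + 1, by grind⟩, ⟨0, e⟩, ⟨0 + 1 + 1 + 1 + 1, by grind⟩, ⟨0 + 1 + 1 + 1, by grind⟩,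
    ⟨0 + 1 + 1, by grind⟩]

/-- The local condition below is constant along the edges of `M ∪ N` and holds vacuously in column
1, hence holds at every vertex. -/
theorem rung_conditions (h : ConnectedExtension c k H B A) (s : Bool) (x : R) :
    (c x = 3 → ¬ A (x - 1)) ∧ (c x = 0 → ¬ A (x + 1)) ∧
      (c x = 4 → (H s x ∧ B s (x + 1 + 1)) ∨ (H s (x - 1) ∧ B s (x - 1 - 1))) := by
  have hsub := h.col_sub_one
  have hcases := h.col_cases
  obtain ⟨x₀, hx₀⟩ := h.exists_col_eq_one
  obtain ⟨hc, hadd, haddk, hb, hdeg, h03, h1, h4, hconn⟩ := h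
  unfold ExactlyOne at hdeg
  revert s x
  refine (hconn (fun s x ↦ (c x = 3 → ¬ A (x - 1)) ∧ (c x = 0 → ¬ A (x + 1)) ∧
    (c x = 4 → (H s x ∧ B s (x + 1 + 1)) ∨ (H s (x - 1) ∧ B s (x - 1 - 1)))) ?_ ?_ ?_).resolve_right
      fun h ↦ h false x₀ (by simp [hx₀])
  · intro s x h
    have c1 := hadd x
    have c2 := hsub x
    have a1 := hdeg s x
    have a2 := hdeg s (x + 1)
    have a3 := hdeg s (x - 1)
    have a4 := hdeg s (x + 1 + 1)
    have m0 := h03 (x + 1)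
    have m1 := h1 s x
    have m2 := h1 s (x + 1 + 1)
    have m3 := hadd (x + 1)
    have m4 := hsub (x - 1)
    have m5 := h1 s (x - 1 - 1)
    simp only [add_sub_cancel_right] at *
    obtain e | e | e | e | e := hcases x
    all_goals
      clear hconn h03 h1 h4 hadd hsub haddk hc hdeg hcases
      simp only [e] at *; norm_num at *; try grind
  · intro x h
    have m := h03 x
    have a1 := hdeg false x
    have a2 := hdeg true x
    clear hconn h03 h1 h4 hadd hsub haddk hc hdeg
    obtain e | e | e | e | e := hcases x
    all_goals
      clear hcases
      simp only [e] at *; norm_num at *; try grind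
  · intro x h
    have c0 := haddk x
    have c1 := hadd x
    have c2 := hsub x
    have c3 := hadd (x + 1)
    have c4 := hsub (x - 1)
    have a1 := fun s ↦ hdeg s (x + cond s k 0)
    have a2 := fun s ↦ hdeg s (x + 1 + cond s k 0)
    have a3 := fun s ↦ hdeg s (x - 1 + cond s k 0)
    have a4 := fun s ↦ hdeg s (x + 1 + 1 + cond s k 0)
    have a5 := fun s ↦ hdeg s (x - 1 - 1 + cond s k 0)
    have d1 := haddk (x + 1)
    have d2 := haddk (x - 1)
    have d3 := haddk (x + 1 + 1)
    have d4 := haddk (x - 1 - 1)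
    have m0 := fun s ↦ h1 s (x + 1 + cond s k 0)
    have m1 := fun s ↦ h1 s (x - 1 - 1 + cond s k 0)
    have m2 := fun s ↦ h03 (x + 1 + cond s k 0)
    have m3 := fun s ↦ h03 (x - 1 + cond s k 0)
    have e1 : x + k + 1 = x + 1 + k := by ring
    have e2 : x + 1 + k - 1 = x + k := by ring
    have e3 : x + k - 1 = x - 1 + k := by ring
    have e4 : x - 1 + k - 1 = x - 1 - 1 + k := by ring
    have e5 : x + 1 + k + 1 = x + 1 + 1 + k := by ring
    have e6 : x + 1 + 1 + k - 1 = x + 1 + k := by ring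
    simp only [add_sub_cancel_right, add_zero, e1, e2, e3, e4, e5, e6, Bool.forall_bool, cond,
      hb] at *
    obtain e | e | e | e | e := hcases x
    all_goals
      clear hconn h03 h1 h4 hadd hsub haddk hc hdeg hcases
      simp only [e] at *; norm_num at *; try grind

theorem not_straight_of_col (h : ConnectedExtension c k H B A) {x : R} (hx : c x = 1 ∨ c x = 2) :
    ¬ A x := by
  have hsub := h.col_sub_one
  have hadd := h.col_add_one
  have key := h.rung_conditions
  rcases hx with h | h
  · have := (key false (x - 1)).2.1 (by rw [hsub, h])
    rwa [sub_add_cancel] at this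
  · have := (key false (x + 1)).1 (by rw [hadd, h])
    rwa [add_sub_cancel_right] at this

theorem horizontal_of_col_eq_four (h : ConnectedExtension c k H B A) (s : Bool) {x : R}
    (hx : c x = 4) :
    (H s x ∧ B s (x + 1 + 1)) ∨ (H s (x - 1) ∧ B s (x - 1 - 1)) :=
  (h.rung_conditions s x).2.2 hx

theorem not_skew_and_skew (h : ConnectedExtension c k H B A) {x : R} (hx : c x = 1) :
    ¬ (B false x ∧ B false (x + 1)) := by
  rintro ⟨hB, hB'⟩
  have hA (x : R) := h.not_straight_of_col (x := x)
  obtain ⟨hc, hadd, haddk, hb, hdeg, h03, h1, h4, hconn⟩ := h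
  unfold ExactlyOne at hdeg
  have key := hconn (fun s y ↦ y = x + cond s k 0 ∨ y = x + 1 + cond s k 0) ?_ ?_ ?_
  rotate_left
  · intro s y hy
    have e0 : c (x + cond s k 0) = 1 := by cases s <;> simp [hx, haddk]
    have e1 : c (x + 1 + cond s k 0) = 2 := by cases s <;> simp [hx, hadd, haddk]
    have b0 : B s (x + cond s k 0) := by cases s <;> simpa [hb]
    have b1 : B s (x + 1 + cond s k 0) := by cases s <;> simpa [hb]
    have a0 := hdeg s y
    have a1 := hdeg s (y + 1)
    have c1 := hadd y
    have m := h1 s y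
    have r : y + 1 = x + 1 + cond s k 0 ↔ y = x + cond s k 0 := by
      rw [add_right_comm, add_left_inj]
    simp only [add_sub_cancel_right] at a1
    clear hconn h03 h1 h4 hadd haddk hc hdeg hA hb
    grind
  · intro y hy
    have := hA y
    have := hadd x
    have := hdeg false y
    have := hdeg true y
    have := hb x
    have := hb (x + 1)
    have := haddk x
    have := haddk (x + 1)
    simp only [cond, add_zero]
    clear hconn h1 h4 hadd haddk hc hdeg hA hb
    grind
  · intro y hy
    simp
  rcases key with key | key
  · have h2 := hadd x
    have h3 := hadd (x + 1)
    rcases key false (x + 1 + 1) with e | e <;> simp only [cond, add_zero] at e <;> grind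
  · exact key false x (by simp)

theorem skew_or_skew [Finite R] (h : ConnectedExtension c k H B A) {x : R} (hx : c x = 1) :
    B false x ∨ B false (x + 1) := by
  have hsub := h.col_sub_one
  have hc := h.col_lt
  have hdeg := h.degree
  unfold ExactlyOne at hdeg
  classical
  let g (z : R) : R := if c z = 1 ∧ ¬ H false (z - 1 - 1) then z - 5 else z
  have c5 (z) : c (z - 5) = c z := by
    rw [show z - 5 = z - 1 - 1 - 1 - 1 - 1 by ring]
    have := hc z
    grind
  have moved (z) (hz : c z = 1) (hH : ¬ H false (z - 1 - 1)) : B false (z - 5 + 1) := by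
    have := (h.horizontal_of_col_eq_four false (x := z - 1 - 1) (by grind)).resolve_left
      fun h ↦ hH h.1
    convert this.2 using 1
    ring
  have kept (z) (hz : c z = 1) (hH : H false (z - 1 - 1)) : B false z := by
    have := (h.horizontal_of_col_eq_four false (x := z - 1 - 1) (by grind)).resolve_right fun h ↦ by
      have := hdeg false (z - 1 - 1); grind
    simpa using this.2
  have hg : Function.Injective g := by
    intro z w hzw
    simp only [g] at hzw
    split_ifs at hzw with hz hw hw
    · simpa using hzw
    · subst hzw
      exact (h.not_skew_and_skew (by grind) ⟨kept _ (by grind) (by grind), moved z hz.1 hz.2⟩).elim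
    · subst hzw
      exact (h.not_skew_and_skew (by grind) ⟨kept _ (by grind) (by grind), moved w hw.1 hw.2⟩).elim
    · exact hzw
  obtain ⟨z, rfl⟩ := Finite.surjective_of_injective hg x
  simp only [g] at hx ⊢
  split_ifs at hx ⊢ with hz
  · exact .inr (moved z hz.1 hz.2)
  · exact .inl (kept z hx (by grind))

theorem skew_iff_not_skew [Finite R] (h : ConnectedExtension c k H B A) (s : Bool) {x : R}
    (hx : c x = 1) : B s (x + 1) ↔ ¬ B s x := by
  cases s
  · have := h.not_skew_and_skew hx
    have := h.skew_or_skew hx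
    tauto
  · have h' : c (x - k) = 1 := by rw [← h.col_add, sub_add_cancel, hx]
    have := h.not_skew_and_skew h'
    have := h.skew_or_skew h'
    rw [← h.skew_iff, ← h.skew_iff, show x - k + 1 + k = x + 1 by ring, sub_add_cancel] at *
    tauto

theorem contradiction [Finite R] (h : ConnectedExtension c k H B A) : False := by
  have hsub := h.col_sub_one
  have hcases := h.col_cases
  have hA (x : R) := h.not_straight_of_col (x := x)
  have hD (s : Bool) (x : R) := h.horizontal_of_col_eq_four s (x := x)
  have hEF (s : Bool) (x : R) := h.skew_iff_not_skew s (x := x)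
  obtain ⟨x₀, hx₀⟩ := h.exists_col_eq_one
  obtain ⟨hc, hadd, haddk, hb, hdeg, h03, h1, h4, hconn⟩ := h
  unfold ExactlyOne at hdeg
  have key := hconn (fun s x ↦ c x = 0 ∨ (c x = 4 ∧ H s x) ∨ (c x = 1 ∧ ¬ B s x) ∨
    (c x = 2 ∧ ¬ B s (x - 1))) ?_ ?_ ?_
  rotate_left
  · intro s x h
    have c1 := hadd x
    have c2 := hsub x
    have a1 := hdeg s x
    have a2 := hdeg s (x + 1)
    have d1 := hEF s (x - 1)
    have m := h1 s x
    simp only [add_sub_cancel_right, sub_add_cancel] at *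
    obtain e | e | e | e | e := hcases x
    all_goals
      clear hconn h03 h1 h4 hadd hsub haddk hc hdeg hcases hEF hD hA
      simp only [e] at *; norm_num at *; try grind
  · intro x h
    have m := h03 x
    have m' := hA x
    have a1 := hdeg false x
    have a2 := hdeg true x
    have d1 := hD false x
    have d2 := hD true x
    obtain e | e | e | e | e := hcases x
    all_goals
      clear hconn h03 h1 h4 hadd hsub haddk hc hdeg hcases hEF hD hA
      simp only [e] at *; norm_num at *; try grind
  · intro x h
    have m := h03 (x - 1)
    have m' := h03 (x - 1 + k)
    have c3 := haddk (x - 1)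
    have a1 := fun s ↦ hdeg s (x + cond s k 0)
    have a2 := fun s ↦ hdeg s (x - 1 + cond s k 0)
    have a3 := fun s ↦ hdeg s (x - 1 - 1 + cond s k 0)
    have b1 := hb x
    have b2 := hb (x - 1)
    have b3 := hb (x + 1 + 1)
    have b4 := hb (x - 1 - 1)
    have c1 := haddk x
    have c2 := hsub x
    have d1 := hD false x
    have d2 := hD true (x + k)
    have e1 : x + k + 1 + 1 = x + 1 + 1 + k := by ring
    have e3 : x + k - 1 = x - 1 + k := by ring
    have e4 : x - 1 + k - 1 = x - 1 - 1 + k := by ring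
    simp only [e1, e3, e4, Bool.forall_bool, cond, add_zero] at *
    obtain e | e | e | e | e := hcases x
    all_goals
      clear hconn h03 h1 h4 hadd hsub haddk hc hdeg hcases hEF hD hA hb
      simp only [e] at *; norm_num at *; try grind
  rcases key with key | key
  · have := key false (x₀ + 1 + 1)
    simp [hadd, hx₀] at this
  · have := key false (x₀ - 1)
    simp [hsub, hx₀] at this

end ConnectedExtension

namespace SimpleGraph

variable {V : Type} {G : SimpleGraph V}

/-- The matching joining each vertex to its image under an involution. -/
def Subgraph.ofInvolutive (f : V → V) (hf : f.Involutive) (hG : ∀ v, G.Adj v (f v)) :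
    G.Subgraph where
  verts := Set.univ
  Adj v w := f v = w
  adj_sub := by
    rintro v _ rfl
    exact hG v
  edge_vert _ := trivial
  symm := ⟨fun v w h ↦ by rw [← h, hf]⟩

theorem Subgraph.isPerfectMatching_ofInvolutive (f : V → V) (hf : f.Involutive)
    (hG : ∀ v, G.Adj v (f v)) : (ofInvolutive f hf hG).IsPerfectMatching :=
  ⟨fun v _ ↦ ⟨f v, rfl, fun _ h ↦ Eq.symm h⟩, fun _ ↦ trivial⟩

theorem Walk.iff_of_mem_support {P : V → Prop} {u w : V} (p : G.Walk u w)
    (hP : ∀ x y, s(x, y) ∈ p.edges → (P x ↔ P y)) {x : V} (hx : x ∈ p.support) : P u ↔ P x := by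
  induction p with
  | nil => simp_all
  | cons h p ih =>
    simp only [Walk.edges_cons, List.mem_cons, Walk.support_cons] at hP hx
    rcases hx with rfl | hx
    · rfl
    · exact (hP _ _ (.inl rfl)).trans (ih (fun x y h ↦ hP x y (.inr h)) hx)

/-- A union of two matchings forming a Hamiltonian cycle is connected. -/
theorem Walk.IsHamiltonianCycle.forall_or_forall_not [DecidableEq V] {v : V} {p : G.Walk v v}
    (hp : p.IsHamiltonianCycle) {M N : G.Subgraph} (hMN : {e | e ∈ p.edges} = M.edgeSet ∪ N.edgeSet)
    {P : V → Prop} (hM : ∀ x y, M.Adj x y → (P x ↔ P y)) (hN : ∀ x y, N.Adj x y → (P x ↔ P y)) :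
    (∀ x, P x) ∨ ∀ x, ¬ P x := by
  have key (x : V) : P v ↔ P x := p.iff_of_mem_support (fun x y h ↦ by
    have : s(x, y) ∈ M.edgeSet ∪ N.edgeSet := hMN ▸ h
    exact this.elim (hM x y) (hN x y)) (hp.mem_support x)
  by_cases h : P v
  · exact .inl fun x ↦ (key x).1 h
  · exact .inr fun x hx ↦ h ((key x).2 hx)

/-- Two matchings forming a Hamiltonian cycle on at least three vertices are disjoint. -/
theorem Walk.IsHamiltonianCycle.not_adj_of_adj [DecidableEq V] {v : V} {p : G.Walk v v}
    (hp : p.IsHamiltonianCycle) {M N : G.Subgraph} (hMN : {e | e ∈ p.edges} = M.edgeSet ∪ N.edgeSet)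
    (hM : M.IsPerfectMatching) (hN : N.IsPerfectMatching) (hV : ∀ x y : V, ∃ z, z ≠ x ∧ z ≠ y)
    {x y : V} (hx : M.Adj x y) : ¬ N.Adj x y := by
  intro hy
  have closed (L : G.Subgraph) (hL : L.IsPerfectMatching) (h : L.Adj x y) (a b : V)
      (hab : L.Adj a b) : (a = x ∨ a = y) ↔ (b = x ∨ b = y) := by
    have h1 {a b b' : V} (h : L.Adj a b) (h' : L.Adj a b') : b = b' :=
      hL.1.eq_of_adj_left h h'
    constructor
    · rintro (rfl | rfl)
      exacts [.inr (h1 hab h), .inl (h1 hab h.symm)]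
    · rintro (rfl | rfl)
      exacts [.inr (h1 hab.symm h), .inl (h1 hab.symm h.symm)]
  rcases hp.forall_or_forall_not hMN (closed M hM hx) (closed N hN hy) with h | h
  · obtain ⟨z, hz, hz'⟩ := hV x y
    exact (h z).elim hz hz'
  · exact h x (.inl rfl)

end SimpleGraph

/-- The other endpoint of the edge `u_y v_{y+k}` at the vertex `(s, x)`. -/
def skewPartner {R : Type} [CommRing R] (k : R) (s : Bool) (x : R) : Bool × R :=
  (!s, if s then x - k else x + k)

theorem accordion_adj_iff {n k : ℕ} (hn : 3 ≤ n) (s : Bool) (x : ZMod n) (w : Bool × ZMod n) :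
    (accordion n k).Adj (s, x) w ↔
      w = (s, x + 1) ∨ w = (s, x - 1) ∨ w = (!s, x) ∨ w = skewPartner (k : ZMod n) s x := by
  have : Fact (1 < n) := ⟨by omega⟩
  obtain ⟨t, y⟩ := w
  have h1 : (1 : ZMod n) ≠ 0 := one_ne_zero
  simp only [accordion, SimpleGraph.fromRel_adj, skewPartner, Prod.mk.injEq, ne_eq]
  cases s <;> cases t <;> simp <;> grind

/-- The matching of the accordion graph given by the columns: straight edges in columns 0 and 3,
horizontal edges between columns 1 and 2, skew edges in column 4. -/
def columnPartner {R : Type} [CommRing R] (c : R → ℕ) (k : R) (v : Bool × R) : Bool × R :=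
  if c v.2 = 1 then (v.1, v.2 + 1)
  else if c v.2 = 2 then (v.1, v.2 - 1)
  else if c v.2 = 4 then skewPartner k v.1 v.2
  else (!v.1, v.2)

theorem columnPartner_involutive {R : Type} [CommRing R] {c : R → ℕ} {k : R}
    (hadd : ∀ x, c (x + 1) = (c x + 1) % 5) (hsub : ∀ x, c (x - 1) = (c x + 4) % 5)
    (hk : ∀ x, c (x + k) = c x) : (columnPartner c k).Involutive := by
  rintro ⟨s, x⟩
  have hk' : c (x - k) = c x := by rw [← hk, sub_add_cancel]
  unfold columnPartner skewPartner
  split_ifs <;> simp_all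

theorem columnPartner_adj {n k : ℕ} (hn : 3 ≤ n) (c : ZMod n → ℕ) (v : Bool × ZMod n) :
    (accordion n k).Adj v (columnPartner c (k : ZMod n) v) := by
  rw [accordion_adj_iff hn]
  unfold columnPartner
  split_ifs <;> simp

/-- A perfect matching whose union with the column matching is connected and which is disjoint from
the column matching is described by a `ConnectedExtension`. -/
theorem connectedExtension_of_isPerfectMatching {n k : ℕ} (hn : 3 ≤ n) (hk : 0 < k) (hkn : k < n)
    {c : ZMod n → ℕ} (hc : ∀ x, c x < 5) (hadd : ∀ x, c (x + 1) = (c x + 1) % 5)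
    (hsub : ∀ x, c (x - 1) = (c x + 4) % 5) (haddk : ∀ x, c (x + k) = c x)
    {N : (accordion n k).Subgraph} (hN : N.IsPerfectMatching)
    (hdisj : ∀ v, ¬ N.Adj v (columnPartner c (k : ZMod n) v))
    (hconn : ∀ P : Bool × ZMod n → Prop, (∀ v, P v ↔ P (columnPartner c (k : ZMod n) v)) →
      (∀ v w, N.Adj v w → (P v ↔ P w)) → (∀ v, P v) ∨ ∀ v, ¬ P v) :
    ConnectedExtension c (k : ZMod n) (fun s x ↦ N.Adj (s, x) (s, x + 1))
      (fun s x ↦ N.Adj (s, x) (skewPartner (k : ZMod n) s x))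
      (fun x ↦ N.Adj (false, x) (true, x)) where
  col_lt := hc
  col_add_one := hadd
  col_add := haddk
  skew_iff x := by simp [skewPartner, N.adj_comm]
  degree s x := by
    have hk0 : (k : ZMod n) ≠ 0 := by
      rw [Ne, ZMod.natCast_eq_zero_iff]
      exact Nat.not_dvd_of_pos_of_lt hk hkn
    have hH : N.Adj (s, x - 1) (s, x - 1 + 1) ↔ N.Adj (s, x) (s, x - 1) := by
      rw [sub_add_cancel, N.adj_comm]
    have hA : N.Adj (false, x) (true, x) ↔ N.Adj (s, x) (!s, x) := by
      cases s
      · rfl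
      · exact N.adj_comm _ _
    have h1 : x + 1 ≠ x - 1 := fun e ↦ by
      have := hadd (x - 1)
      have := hadd x
      have := hc (x - 1)
      grind
    have h2 : x ≠ if s then x - (k : ZMod n) else x + k := by
      cases s <;> grind
    obtain ⟨w, hw, huniq⟩ := hN.1 (hN.2 (s, x))
    have hiff (v : Bool × ZMod n) : N.Adj (s, x) v ↔ v = w :=
      ⟨huniq v, fun e ↦ e ▸ hw⟩
    have hcases := (accordion_adj_iff hn s x w).1 hw.adj_sub
    simp only [ExactlyOne, hH, hA, hiff]
    unfold skewPartner at *
    cases s <;> grind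
  not_straight x hx := by
    have := hdisj (false, x)
    simpa [columnPartner, show c x ≠ 1 by omega, show c x ≠ 2 by omega, show c x ≠ 4 by omega]
  not_horizontal s x hx := by simpa [columnPartner, hx] using hdisj (s, x)
  not_skew s x hx := by simpa [columnPartner, hx] using hdisj (s, x)
  connected P hH hA hB := by
    have hA' (s : Bool) (x : ZMod n) (h : N.Adj (s, x) (!s, x) ∨ c x = 0 ∨ c x = 3) :
        P s x ↔ P (!s) x := by
      cases s
      · exact hA x h
      · exact (hA x (h.imp_left .symm)).symm
    have hB' (s : Bool) (x : ZMod n) (h : N.Adj (s, x) (skewPartner (k : ZMod n) s x) ∨ c x = 4) :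
        P s x ↔ P (skewPartner (k : ZMod n) s x).1 (skewPartner (k : ZMod n) s x).2 := by
      cases s
      · exact hB x h
      · have := hB (x - k) (by
          rw [← haddk (x - k)]
          simpa [skewPartner, N.adj_comm] using h)
        simpa [skewPartner] using this.symm
    have hH' (s : Bool) (x : ZMod n) (h : N.Adj (s, x) (s, x - 1) ∨ c x = 2) :
        P s x ↔ P s (x - 1) := by
      have := hH s (x - 1) (by
        rw [sub_add_cancel, N.adj_comm, hsub]
        exact h.imp_right fun h ↦ by rw [h])
      rw [sub_add_cancel] at this
      exact this.symm
    have := hconn (fun v ↦ P v.1 v.2) ?_ ?_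
    · simpa using this
    · rintro ⟨s, x⟩
      have := hc x
      unfold columnPartner
      split_ifs with h1 h2 h4
      · exact hH s x (.inr h1)
      · exact hH' s x (.inr h2)
      · exact hB' s x (.inr h4)
      · exact hA' s x (.inr (by grind))
    · rintro ⟨s, x⟩ w h
      rcases (accordion_adj_iff hn s x w).1 h.adj_sub with rfl | rfl | rfl | rfl
      exacts [hH s x (.inl h), hH' s x (.inl h), hA' s x (.inl h), hB' s x (.inl h)]

/-- If `gcd(n,k) = 5`, the accordion graph `A[n,k]` does not have the PMH-property. -/
theorem accordion_not_isPMH_of_gcd_eq_five (n k : ℕ) (hn : 3 ≤ n) (hk : 0 < k)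
    (hkn : 2 * k ≤ n) (hgcd : Nat.gcd n k = 5) : ¬ IsPMH (accordion n k) := by
  intro h
  have h5n : 5 ∣ n := hgcd ▸ Nat.gcd_dvd_left n k
  have h5k : 5 ∣ k := hgcd ▸ Nat.gcd_dvd_right n k
  have : NeZero n := ⟨by omega⟩
  let c (x : ZMod n) : ℕ := (ZMod.castHom h5n (ZMod 5) x).val
  have hc (x) : c x < 5 := ZMod.val_lt _
  have hadd (x) : c (x + 1) = (c x + 1) % 5 := by
    simp only [c, map_add, map_one, ZMod.val_add]
    rfl
  have hsub (x) : c (x - 1) = (c x + 4) % 5 := by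
    have := hadd (x - 1)
    have := hc (x - 1)
    rw [sub_add_cancel] at *
    omega
  have haddk (x) : c (x + k) = c x := by
    simp only [c, map_add, map_natCast, (ZMod.natCast_eq_zero_iff k 5).2 h5k, add_zero]
  have hinv := columnPartner_involutive hadd hsub haddk
  have hM := Subgraph.isPerfectMatching_ofInvolutive _ hinv (columnPartner_adj hn c)
  obtain ⟨N, hN, v, p, hp, hMN⟩ := h _ hM
  have hV (x y : Bool × ZMod n) : ∃ z, z ≠ x ∧ z ≠ y := by
    have hcard : ({x, y} : Finset _).card < (Finset.univ : Finset (Bool × ZMod n)).card := by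
      rw [Finset.card_univ, Fintype.card_prod, Fintype.card_bool, ZMod.card]
      exact Finset.card_le_two.trans_lt (by omega)
    obtain ⟨z, -, hz⟩ := Finset.exists_mem_notMem_of_card_lt_card hcard
    exact ⟨z, by simpa using hz⟩
  exact (connectedExtension_of_isPerfectMatching hn hk (by omega) hc hadd hsub haddk hN
    (fun v ↦ hp.not_adj_of_adj hMN hM hN hV rfl)
    (fun P hP hP' ↦ hp.forall_or_forall_not hMN (by rintro x _ rfl; exact hP x) hP')).contradiction
end
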